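/- (Path Straightening) Let K be a CAT(0) regular simplicial 3-complex, and let α and β be combinatorial paths in K starting at a vertex u and ending at a vertex w. If β is a (possibly constant) combinatorial geodesic, then α can be transformed into β by applying a finite sequence of basic moves, each of which is length-preserving or length-reducing. If both α and β are combinatorial geodesics, then all the moves are length-preserving (triangle-triangle moves). -/

import Mathlib

open scoped Classical

noncomputable section

/-! ## Abstract simplicial complexes and their piecewise Euclidean geometry

An (abstract, regular) simplicial complex on a vertex type `V` is a collection of nonempty
finite vertex sets (its simplices), closed under passage to nonempty subsets.  It is regarded
as a *regular* piecewise Euclidean complex: every `n`-simplex is isometric to the regular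
Euclidean `n`-simplex with unit edge lengths, glued along faces by isometries.  This geometry
is built into the intrinsic metric on the geometric realization defined below. -/

structure SC (V : Type*) where
  faces : Set (Finset V)
  not_mem_empty : ∅ ∉ faces
  down : ∀ s ∈ faces, ∀ t : Finset V, t ⊆ s → t ≠ ∅ → t ∈ faces

variable {V : Type*} [DecidableEq V]

/-- The complex has dimension at most `3` (every simplex has at most 4 vertices). -/
def SC.Is3Dim (K : SC V) : Prop := ∀ s ∈ K.faces, s.card ≤ 4

/-- A point of the geometric realization of `K`, in barycentric coordinates. -/
def SC.IsPoint (K : SC V) (x : V →₀ ℝ) : Prop :=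
  (∀ v, 0 ≤ x v) ∧ (x.sum fun _ r => r) = 1 ∧ x.support ∈ K.faces

/-- Two realization points lie in a common closed simplex of `K`. -/
def SC.SameCell (K : SC V) (x y : V →₀ ℝ) : Prop := x.support ∪ y.support ∈ K.faces

/-- The Euclidean distance between two points of a common *regular unit-edge* simplex, in
barycentric coordinates: realizing the vertices as `eᵥ/√2` in `ℓ²(V)` gives a regular simplex
with unit edge lengths, and the induced distance is `√(∑ (xᵥ - yᵥ)² / 2)`. -/
def stepD (x y : V →₀ ℝ) : ℝ := Real.sqrt (((x - y).sum fun _ r => r ^ 2) / 2)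

/-- A chain of realization points in which consecutive points share a simplex. -/
def SC.IsChain (K : SC V) (c : List (V →₀ ℝ)) : Prop :=
  (∀ z ∈ c, K.IsPoint z) ∧ c.Chain' K.SameCell

/-- The length of a chain of realization points. -/
def chLen (c : List (V →₀ ℝ)) : ℝ := ((c.zip c.tail).map fun p => stepD p.1 p.2).sum

/-- The intrinsic (length) metric of the regular piecewise Euclidean complex `K`:
the infimum of lengths of piecewise linear chains joining two realization points. -/
def SC.pdist (K : SC V) (x y : V →₀ ℝ) : ℝ :=
  sInf {L | ∃ c, K.IsChain c ∧ c.head? = some x ∧ c.getLast? = some y ∧ chLen c = L}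

/-- `K` is CAT(0): its geometric realization with the intrinsic piecewise Euclidean metric is
chain-connected, midpoints exist (so the metric is geodesic), and every midpoint satisfies the
Bruhat–Tits CN comparison inequality.  For geodesic spaces this is the standard comparison
formulation of the CAT(0) condition, which (by the Cartan–Hadamard theorem and Gromov's link
condition) is equivalent to: connected, simply connected, and no metric link contains a
locally geodesic loop of length less than `2 * π`. -/
def SC.IsCAT0 (K : SC V) : Prop :=
  K.faces.Nonempty ∧
  (∀ x y, K.IsPoint x → K.IsPoint y →
    ∃ c, K.IsChain c ∧ c.head? = some x ∧ c.getLast? = some y) ∧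
  (∀ x y, K.IsPoint x → K.IsPoint y →
    ∃ m, K.IsPoint m ∧ K.pdist x m = K.pdist x y / 2 ∧ K.pdist m y = K.pdist x y / 2) ∧
  (∀ x y z m, K.IsPoint x → K.IsPoint y → K.IsPoint z → K.IsPoint m →
    K.pdist y m = K.pdist y z / 2 → K.pdist m z = K.pdist y z / 2 →
    K.pdist x m ^ 2 ≤ K.pdist x y ^ 2 / 2 + K.pdist x z ^ 2 / 2 - K.pdist y z ^ 2 / 4)

/-- Adjacency of vertices in the 1-skeleton of `K`. -/
def SC.adj (K : SC V) (u v : V) : Prop := u ≠ v ∧ ({u, v} : Finset V) ∈ K.faces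

/-! ## Combinatorial paths -/

/-- A combinatorial edge path with respect to an adjacency relation `E`: an eventually
constant function `ℕ → V` traversing an edge at each time `i < len`.  (Equivalently, an
alternating sequence `[v₀, e₁, v₁, …, e_n, v_n]` of vertices and edges with `eᵢ` spanned by
`{v_{i-1}, v_i}`; its parameterization is constant after time `len`.) -/
structure EPath {V : Type*} (E : V → V → Prop) where
  f : ℕ → V
  len : ℕ
  step : ∀ i, i < len → E (f i) (f (i + 1))
  stable : ∀ i, len ≤ i → f i = f len

namespace EPath

variable {E : V → V → Prop}

/-- The starting vertex. -/
def src (p : EPath E) : V := p.f 0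

/-- The ending vertex. -/
def dst (p : EPath E) : V := p.f p.len

/-- A combinatorial loop. -/
def Closed (p : EPath E) : Prop := p.dst = p.src

/-- A path is tight if it does not cross the same (unordered) edge twice. -/
def Tight (p : EPath E) : Prop :=
  ∀ i j, i < p.len → j < p.len →
    ({p.f i, p.f (i + 1)} : Finset V) = ({p.f j, p.f (j + 1)} : Finset V) → i = j

/-- The word of vertices read by a path. -/
def word (p : EPath E) : List V := (List.range (p.len + 1)).map p.f

end EPath

/-- The combinatorial distance between two vertices: the least length of an edge path. -/
def SC.cd (K : SC V) (u v : V) : ℕ :=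
  sInf {n | ∃ p : EPath K.adj, p.src = u ∧ p.dst = v ∧ p.len = n}

/-- A combinatorial geodesic: a path of minimal length between its endpoints. -/
def SC.IsGeo (K : SC V) (p : EPath K.adj) : Prop := p.len = K.cd p.src p.dst

/-! ## Basic moves on combinatorial paths -/

/-- A trivial move: delete a backtracking subpath `a, b, a`, replacing it by `a`. -/
def TrivMove (K : SC V) (p q : EPath K.adj) : Prop :=
  ∃ i, i + 2 ≤ p.len ∧ p.f (i + 2) = p.f i ∧ q.len + 2 = p.len ∧
    (∀ j, j ≤ i → q.f j = p.f j) ∧ ∀ j, i ≤ j → j ≤ q.len → q.f j = p.f (j + 2)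

/-- A triangle move: replace two sides `a, b, c` of a triangle of `K` by the third side `a, c`. -/
def TriMove (K : SC V) (p q : EPath K.adj) : Prop :=
  ∃ i, i + 2 ≤ p.len ∧
    ({p.f i, p.f (i + 1), p.f (i + 2)} : Finset V) ∈ K.faces ∧
    ({p.f i, p.f (i + 1), p.f (i + 2)} : Finset V).card = 3 ∧
    q.len + 1 = p.len ∧
    (∀ j, j ≤ i → q.f j = p.f j) ∧ ∀ j, i < j → j ≤ q.len → q.f j = p.f (j + 1)

/-- A triangle-triangle move: across two triangles `{a, b, x}` and `{b, x, c}` of `K` sharing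
the edge `{b, x}`, replace the arc `a, b, c` by the arc `a, x, c` (where `a, c` are the two
opposite degree-two vertices of the doubly based disk). -/
def TTMove (K : SC V) (p q : EPath K.adj) : Prop :=
  ∃ i x, 0 < i ∧ i < p.len ∧ q.len = p.len ∧ q.f i = x ∧ (∀ j, j ≠ i → q.f j = p.f j) ∧
    x ≠ p.f i ∧ p.f (i - 1) ≠ p.f (i + 1) ∧
    ({p.f (i - 1), p.f i, x} : Finset V) ∈ K.faces ∧
    ({p.f (i - 1), p.f i, x} : Finset V).card = 3 ∧
    ({p.f i, x, p.f (i + 1)} : Finset V) ∈ K.faces ∧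
    ({p.f i, x, p.f (i + 1)} : Finset V).card = 3

/-- A basic move: a trivial move, a triangle move, or a triangle-triangle move.  Trivial and
triangle moves are length-reducing; triangle-triangle moves are length-preserving. -/
def BasicMove (K : SC V) (p q : EPath K.adj) : Prop :=
  TrivMove K p q ∨ TriMove K p q ∨ TTMove K p q

/-! ## Disk diagrams -/

/-- Points of the Euclidean plane. -/
abbrev Pt2 : Type := ℝ × ℝ

/-- A simplicial disk diagram: a finite 2-complex embedded in the Euclidean plane `ℝ²`
(vertices are points, edges are straight segments, 2-cells are nondegenerate triangles, and
any two cells meet in the realization of their common face), whose support (the union of its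
cells) is contractible. -/
structure SimpDisk where
  verts : Finset Pt2
  edges : Finset (Finset Pt2)
  facesD : Finset (Finset Pt2)
  verts_nonempty : verts.Nonempty
  edge_card : ∀ e ∈ edges, e.card = 2
  edge_sub : ∀ e ∈ edges, e ⊆ verts
  face_card : ∀ t ∈ facesD, t.card = 3
  face_sub : ∀ t ∈ facesD, t ⊆ verts
  face_edges : ∀ t ∈ facesD, ∀ e : Finset Pt2, e ⊆ t → e.card = 2 → e ∈ edges
  face_nondegen : ∀ t ∈ facesD, ¬ Collinear ℝ (t : Set Pt2)
  glue : ∀ s ∈ verts.image (fun v => ({v} : Finset Pt2)) ∪ edges ∪ facesD,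
         ∀ t ∈ verts.image (fun v => ({v} : Finset Pt2)) ∪ edges ∪ facesD,
      convexHull ℝ (s : Set Pt2) ∩ convexHull ℝ (t : Set Pt2) =
        convexHull ℝ ((s ∩ t : Finset Pt2) : Set Pt2)
  contractible : ContractibleSpace
    (⋃ s ∈ (verts.image (fun v => ({v} : Finset Pt2)) ∪ edges ∪ facesD : Finset (Finset Pt2)),
      convexHull ℝ (s : Set Pt2))

namespace SimpDisk

/-- The cells of a disk diagram. -/
def cells (D : SimpDisk) : Finset (Finset Pt2) :=
  D.verts.image (fun v => ({v} : Finset Pt2)) ∪ D.edges ∪ D.facesD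

/-- The support of a disk diagram: the union of its closed cells in the plane. -/
def supp (D : SimpDisk) : Set Pt2 := ⋃ s ∈ D.cells, convexHull ℝ (s : Set Pt2)

/-- A disk diagram is nonsingular if it is homeomorphic to the closed unit disk;
otherwise it is singular (it has a cut point). -/
def Nonsingular (D : SimpDisk) : Prop :=
  Nonempty (D.supp ≃ₜ (Metric.closedBall (0 : Pt2) 1 : Set Pt2))

/-- The degree of a vertex: the number of edges of `D` incident to it. -/
def deg (D : SimpDisk) (v : Pt2) : ℕ := (D.edges.filter fun e => v ∈ e).card

/-- A boundary vertex of a disk diagram. -/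
def BVert (D : SimpDisk) (v : Pt2) : Prop := v ∈ D.verts ∧ v ∈ frontier D.supp

/-- An interior vertex of a disk diagram. -/
def IVert (D : SimpDisk) (v : Pt2) : Prop := v ∈ D.verts ∧ v ∈ interior D.supp

/-- A boundary edge of a disk diagram. -/
def BEdge (D : SimpDisk) (e : Finset Pt2) : Prop :=
  e ∈ D.edges ∧ convexHull ℝ (e : Set Pt2) ⊆ frontier D.supp

/-- Adjacency in the 1-skeleton of a disk diagram. -/
def adj (D : SimpDisk) (a b : Pt2) : Prop := a ≠ b ∧ ({a, b} : Finset Pt2) ∈ D.edges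

/-- The combinatorial area of a simplicial disk: the number of its triangles. -/
def area (D : SimpDisk) : ℕ := D.facesD.card

/-- The boundary cycle of a disk diagram: a closed edge path traversing exactly the
boundary edges of `D`. -/
def IsBoundaryCycle (D : SimpDisk) (c : EPath D.adj) : Prop :=
  c.Closed ∧ (∀ i, i < c.len → D.BEdge {c.f i, c.f (i + 1)}) ∧
  (∀ e : Finset Pt2, D.BEdge e → ∃ i, i < c.len ∧ e = {c.f i, c.f (i + 1)}) ∧
  (∀ v, D.BVert v → ∃ i, i ≤ c.len ∧ c.f i = v)

end SimpDisk

/-- A disk diagram spanning the combinatorial loop `α` in the complex `K`: a simplicial disk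
`D` together with a simplicial map `D → K` whose restriction to the boundary cycle of `D`
is `α`. -/
structure SpanningDisk (K : SC V) (α : EPath K.adj) where
  D : SimpDisk
  fmap : Pt2 → V
  cellmap : ∀ s ∈ D.cells, s.image fmap ∈ K.faces
  bc : EPath D.adj
  bc_is : D.IsBoundaryCycle bc
  bc_len : bc.len = α.len
  bc_map : ∀ i, fmap (bc.f i) = α.f i

/-- A spanning disk of minimal combinatorial area among the disks spanning the same loop. -/
def SpanningDisk.IsMinimal {K : SC V} {α : EPath K.adj} (S : SpanningDisk K α) : Prop :=
  ∀ S' : SpanningDisk K α, S.D.area ≤ S'.D.area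

/-- An empty `n`-gon: a tight combinatorial loop of length `n` all of whose minimal spanning
disks have an interior vertex. -/
def SC.IsEmptyNgon (K : SC V) (α : EPath K.adj) (n : ℕ) : Prop :=
  α.Closed ∧ α.Tight ∧ α.len = n ∧
  ∀ S : SpanningDisk K α, S.IsMinimal → ∃ v : Pt2, S.D.IVert v

/-! ## Flagness, fullness, links -/

/-- A complex is flag if every nonempty finite set of vertices pairwise joined by edges
spans a simplex. -/
def SC.IsFlag (K : SC V) : Prop :=
  ∀ s : Finset V, s.Nonempty → (∀ v ∈ s, ({v} : Finset V) ∈ K.faces) →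
    (∀ u ∈ s, ∀ w ∈ s, u ≠ w → ({u, w} : Finset V) ∈ K.faces) → s ∈ K.faces

/-- `L` is a full subcomplex of `K`: a subcomplex containing every simplex of `K` whose
vertices all lie in `L`. -/
def SC.FullIn (L K : SC V) : Prop :=
  L.faces ⊆ K.faces ∧ ∀ s ∈ K.faces, (∀ v ∈ s, ({v} : Finset V) ∈ L.faces) → s ∈ L.faces

/-- The (metric) link of a vertex `v` of `K`, described combinatorially: its simplices
correspond to the simplices `t` of `K` with `insert v t` a simplex of `K` (a vertex of the
link corresponds to an edge of `K` incident to `v`, i.e. to its unit tangent direction). -/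
def SC.link (K : SC V) (v : V) : SC V where
  faces := {t | t ∈ K.faces ∧ v ∉ t ∧ insert v t ∈ K.faces}
  not_mem_empty := fun h => K.not_mem_empty h.1
  down := by
    rintro s ⟨hs, hvs, hins⟩ t hts htne
    refine ⟨K.down s hs t hts htne, fun hvt => hvs (hts hvt), ?_⟩
    refine K.down _ hins _ (Finset.insert_subset_insert v hts) ?_
    simp

/-- The combinatorial link of a simplex `σ` of `K`: the union of all simplices `t` such that
`t ∗ σ = t ∪ σ` is a simplex of `K`. -/
def SC.clink (K : SC V) (σ : Finset V) : SC V where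
  faces := {t | t ∈ K.faces ∧ Disjoint t σ ∧ t ∪ σ ∈ K.faces}
  not_mem_empty := fun h => K.not_mem_empty h.1
  down := by
    rintro s ⟨hs, hdisj, huni⟩ t hts htne
    refine ⟨K.down s hs t hts htne, hdisj.mono_left hts, ?_⟩
    refine K.down _ huni _ (Finset.union_subset_union hts (subset_refl σ)) ?_
    intro h
    exact htne (Finset.union_eq_empty.mp h).1

/-- A complex is `k`-large if it is flag and contains no empty `n`-gons for `n < k`. -/
def SC.IsKLarge (K : SC V) (k : ℕ) : Prop :=
  K.IsFlag ∧ ∀ (α : EPath K.adj) (n : ℕ), n < k → ¬ K.IsEmptyNgon α n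

/-- A complex is systolic (satisfies simplicial nonpositive curvature) if the combinatorial
link of every simplex is 6-large. -/
def SC.IsSystolic (K : SC V) : Prop := ∀ σ ∈ K.faces, (K.clink σ).IsKLarge 6

/-! ## Gersten–Short geodesics -/

/-- The diagonal condition for a path lifted along the boundary of a disk `D` via `c` at
offset `o`, of length `n`: whenever the `j`-th vertex is positive (`4 - deg > 0`), the
`(j-1)`-st vertex is negative (`4 - deg < 0`), for `1 ≤ j ≤ n - 1`. -/
def DiagCondAt (D : SimpDisk) (c : ℕ → Pt2) (o n : ℕ) : Prop :=
  ∀ j, 0 < j → j < n → D.deg (c (o + j)) < 4 → 4 < D.deg (c (o + j - 1))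

/-- A Gersten–Short geodesic: a combinatorial geodesic satisfying the diagonal condition
along every minimal (possibly singular) spanning disk having it along its boundary. -/
def IsGS (K : SC V) (γ : EPath K.adj) : Prop :=
  K.IsGeo γ ∧
  ∀ (β : EPath K.adj), β.Closed →
    ∀ S : SpanningDisk K β, S.IsMinimal →
      ∀ o : ℕ, o + γ.len ≤ S.bc.len →
        (∀ j, j ≤ γ.len → S.fmap (S.bc.f (o + j)) = γ.f j) →
          DiagCondAt S.D S.bc.f o γ.len

/-! ## Finite state automata and regular path systems -/

/-- A finite state automaton over the alphabet `A`: a finite labeled directed graph with a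
distinguished start vertex and a set of accept vertices. -/
structure FSA (A : Type*) where
  n : ℕ
  start : Fin n
  accept : Finset (Fin n)
  trans : Set (Fin n × A × Fin n)
  trans_finite : trans.Finite

/-- A word is accepted by an FSA if it labels a directed path from the start vertex to an
accept vertex. -/
def FSA.Accepts {A : Type*} (M : FSA A) (w : List A) : Prop :=
  ∃ q : ℕ → Fin M.n, q 0 = M.start ∧ q w.length ∈ M.accept ∧
    ∀ (i : ℕ) (h : i < w.length), (q i, w.get ⟨i, h⟩, q (i + 1)) ∈ M.trans

/-- A path system is regular if the set of its vertex words is the language accepted by some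
finite state automaton. -/
def RegularSystem {E : V → V → Prop} (P : Set (EPath E)) : Prop :=
  ∃ M : FSA V, ∀ w : List V, M.Accepts w ↔ ∃ p ∈ P, p.word = w

/-- `U` is the union of the disk diagrams `D1` and `D2` glued exactly along the combinatorial
path read by `c1` (resp. `c2`) at offset `o1` (resp. `o2`) for `n` steps. -/
def IsUnionAlong (U D1 D2 : SimpDisk) (c1 c2 : ℕ → Pt2) (o1 o2 n : ℕ) : Prop :=
  U.verts = D1.verts ∪ D2.verts ∧
  U.edges = D1.edges ∪ D2.edges ∧
  U.facesD = D1.facesD ∪ D2.facesD ∧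
  (∀ j, j ≤ n → c1 (o1 + j) = c2 (o2 + j)) ∧
  D1.verts ∩ D2.verts = (Finset.range (n + 1)).image (fun j => c1 (o1 + j)) ∧
  D1.edges ∩ D2.edges =
    (Finset.range n).image (fun j => ({c1 (o1 + j), c1 (o1 + j + 1)} : Finset Pt2)) ∧
  D1.facesD ∩ D2.facesD = ∅

end

section Combi

variable {V : Type*}

/-- `w` is reached from `v` by a path of length `k` inside `B`. -/
def Rch (G : SimpleGraph V) (B : Set V) (v : V) : ℕ → V → Prop
  | 0, w => w = v ∧ v ∈ B
  | k + 1, w => ∃ y, Rch G B v k y ∧ G.Adj y w ∧ w ∈ B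

/-- Lower neighbours at level `n` of a vertex of level `n+1` are adjacent. -/
def INC (G : SimpleGraph V) (n : ℕ) : Prop :=
  ∀ u z v w, G.dist u z = n + 1 → G.Adj z v → G.Adj z w → G.dist u v = n → G.dist u w = n →
    v = w ∨ G.Adj v w

/-- The triangle condition at level `n+1`. -/
def TCond (G : SimpleGraph V) (n : ℕ) : Prop :=
  ∀ u v w, G.dist u v = n + 1 → G.dist u w = n + 1 → G.Adj v w →
    ∃ x, G.Adj x v ∧ G.Adj x w ∧ G.dist u x = n

variable {G : SimpleGraph V}

theorem Rch.mem {B : Set V} {v : V} {k : ℕ} {w : V} (h : Rch G B v k w) : w ∈ B := by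
  cases k with
  | zero => obtain ⟨rfl, h⟩ := h; exact h
  | succ k => obtain ⟨y, _, _, h⟩ := h; exact h

theorem Rch.walk {B : Set V} {v : V} {k : ℕ} : ∀ {w : V}, Rch G B v k w →
    ∃ p : G.Walk v w, p.length = k := by
  induction k with
  | zero => rintro w ⟨rfl, h⟩; exact ⟨SimpleGraph.Walk.nil, rfl⟩
  | succ k ih =>
    rintro w ⟨y, h, ha, _⟩
    obtain ⟨p, hp⟩ := ih h
    exact ⟨p.concat ha, by simp [hp]⟩

theorem Rch.dist_le {B : Set V} {v : V} {k : ℕ} {w : V} (h : Rch G B v k w) :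
    G.dist v w ≤ k := by
  obtain ⟨p, rfl⟩ := h.walk
  exact G.dist_le p

theorem Rch.reach {B : Set V} {v : V} {k : ℕ} {w : V} (h : Rch G B v k w) :
    G.Reachable v w := by
  obtain ⟨p, rfl⟩ := h.walk
  exact ⟨p⟩

theorem Rch.trans {B : Set V} {v w : V} {k : ℕ} (h : Rch G B v k w) {l : ℕ} :
    ∀ {z : V}, Rch G B w l z → Rch G B v (k + l) z := by
  induction l with
  | zero => rintro z ⟨rfl, _⟩; exact h
  | succ l ih =>
    rintro z ⟨y, h1, h2, h3⟩
    exact ⟨y, ih h1, h2, h3⟩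

theorem Rch.symm {B : Set V} {v : V} {k : ℕ} : ∀ {w : V}, Rch G B v k w → Rch G B w k v := by
  induction k with
  | zero => rintro w ⟨rfl, h⟩; exact ⟨rfl, h⟩
  | succ k ih =>
    rintro w ⟨y, h1, h2, h3⟩
    have : Rch G B w 1 y := ⟨w, ⟨rfl, h3⟩, h2.symm, h1.mem⟩
    have := this.trans (ih h1)
    rwa [add_comm] at this

theorem dist_adj_le {u v w : V} (h : G.Adj v w) : G.dist u w ≤ G.dist u v + 1 := by
  rcases h.diff_dist_adj (u := u) with h | h | h <;> omega

theorem exists_pred {u w : V} {k : ℕ} (h : G.dist u w = k + 1) :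
    ∃ y, G.Adj y w ∧ G.dist u y = k ∧ G.Reachable u y := by
  have hr : G.Reachable u w := SimpleGraph.Reachable.of_dist_ne_zero (by omega)
  obtain ⟨p, hp⟩ := hr.exists_walk_length_eq_dist
  have hn : ¬ p.Nil := by
    intro hn
    have := SimpleGraph.Walk.length_eq_zero_iff.2 hn
    omega
  refine ⟨p.penultimate, p.adj_penultimate hn, ?_, ⟨p.dropLast⟩⟩
  have h1 := G.dist_le p.dropLast
  have h2 := dist_adj_le (u := u) (p.adj_penultimate hn)
  have h3 : p.dropLast.length = p.length - 1 := by simp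
  omega

theorem exists_mid {u z : V} (hr : G.Reachable u z) (s : ℕ) :
    ∀ t, G.dist u z = s + t → ∃ p, G.dist u p = s ∧ G.dist p z = t ∧ G.Reachable u p := by
  intro t
  induction t generalizing z with
  | zero => intro h; exact ⟨z, h, by simp, hr⟩
  | succ t ih =>
    intro h
    obtain ⟨y, hy, hd, hry⟩ := exists_pred (k := s + t) (by omega)
    obtain ⟨p, h1, h2, h3⟩ := ih hry hd
    refine ⟨p, h1, ?_, h3⟩
    have h4 := dist_adj_le (u := p) hy
    have h5 := h3.dist_triangle_left z
    omega

theorem geoB {B : Set V} {p : V} : ∀ (k : ℕ) {q : V}, G.Reachable p q → G.dist p q = k →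
    (∀ t, G.Reachable p t → G.dist p t + G.dist t q = k → t ∈ B) → Rch G B p k q := by
  intro k
  induction k with
  | zero =>
    intro q hr hd hB
    have : p = q := hr.dist_eq_zero_iff.1 hd
    subst this
    exact ⟨rfl, hB p hr (by simp)⟩
  | succ k ih =>
    intro q hr hd hB
    obtain ⟨y, hy, hdy, hry⟩ := exists_pred hd
    refine ⟨y, ih hry hdy ?_, hy, hB q hr (by simp [hd])⟩
    intro t ht hs
    apply hB t ht
    have h4 := dist_adj_le (u := t) hy
    have h5 := ht.dist_triangle_left q
    omega

theorem ladder {ℓ : ℕ} (hI : ∀ n, 2 * n + 2 < ℓ → INC G n) (hT : ∀ n, 2 * n + 3 < ℓ → TCond G n)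
    {B : Set V} (hloc : ∀ a b c x, a ∈ B → b ∈ B → c ∈ B → x ∉ B → G.Adj a b → G.Adj b c →
      G.Adj x a → G.Adj x b → G.Adj x c → a = c ∨ G.Adj a c) {v : V} :
    ∀ (k : ℕ) {x y : V}, 2 * k + 1 < ℓ → Rch G B v k y → G.dist v y = k → x ∈ B → G.Adj y x →
      G.dist v x = k → Rch G B v k x := by
  intro k
  induction k with
  | zero =>
    intro x y _ h _ _ ha hd
    obtain ⟨rfl, _⟩ := h
    have := SimpleGraph.dist_eq_one_iff_adj.2 ha
    omega
  | succ k ih =>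
    intro x y hk h hy hx ha hd
    obtain ⟨y', h1, h2, h3⟩ := h
    have hy' : G.dist v y' = k := by
      have := h1.dist_le
      have := dist_adj_le (u := v) h2
      omega
    obtain ⟨t, ht1, ht2, ht3⟩ := hT k (by omega) v y x hy hd ha
    have key : G.Adj y' x → Rch G B v (k + 1) x := fun h => ⟨y', h1, h, hx⟩
    rcases hI k (by omega) v y t y' hy ht1.symm h2.symm ht3 hy' with rfl | hadj
    · exact key ht2
    · by_cases htB : t ∈ B
      · exact ⟨t, ih (by omega) h1 hy' htB hadj.symm ht3, ht2, hx⟩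
      · rcases hloc y' y x t h1.mem h3 hx htB h2 ha hadj ht1 ht2 with rfl | h
        · omega
        · exact key h

theorem straightB {ℓ : ℕ} (hI : ∀ n, 2 * n + 2 < ℓ → INC G n)
    (hT : ∀ n, 2 * n + 3 < ℓ → TCond G n)
    {B : Set V} (hloc : ∀ a b c x, a ∈ B → b ∈ B → c ∈ B → x ∉ B → G.Adj a b → G.Adj b c →
      G.Adj x a → G.Adj x b → G.Adj x c → a = c ∨ G.Adj a c) {v : V} :
    ∀ (L : ℕ) {w : V}, Rch G B v L w → L + G.dist v w < ℓ → Rch G B v (G.dist v w) w := by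
  intro L
  induction L with
  | zero =>
    rintro w ⟨rfl, h⟩ _
    rw [SimpleGraph.dist_self]
    exact ⟨rfl, h⟩
  | succ L ih =>
    rintro w ⟨y, h1, h2, h3⟩ hl
    have d1 := dist_adj_le (u := v) h2
    have d2 := dist_adj_le (u := v) h2.symm
    have hy := ih h1 (by omega)
    have d3 := h1.dist_le
    obtain ⟨k, hk⟩ : ∃ k, G.dist v y = k := ⟨_, rfl⟩
    rw [hk] at hy d1 d2 d3
    obtain hc | hc | hc : G.dist v w = k + 1 ∨ G.dist v w = k ∨ G.dist v w + 1 = k := by omega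
    · rw [hc]; exact ⟨y, hy, h2, h3⟩
    · rw [hc]
      cases k with
      | zero =>
        obtain ⟨rfl, _⟩ := hy
        have := SimpleGraph.dist_eq_one_iff_adj.2 h2
        omega
      | succ k => exact ladder hI hT hloc (k + 1) (by omega) hy hk h3 h2 hc
    · cases k with
      | zero => omega
      | succ k =>
        obtain ⟨y', e1, e2, e3⟩ := hy
        have hy' : G.dist v y' = k := by
          have := e1.dist_le
          have := dist_adj_le (u := v) e2
          omega
        have hc' : G.dist v w = k := by omega
        rw [hc']
        rcases hI k (by omega) v y y' w hk e2.symm h2 hy' hc' with rfl | h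
        · exact e1
        · exact ladder hI hT hloc k (by omega) e1 hy' h3 h hc'

end Combi

section Combi2

variable {V : Type*} {G : SimpleGraph V}

/-- The metric input needed for the combinatorial argument. -/
structure MetricInput (G : SimpleGraph V) : Prop where
  c4 : ∀ a b c d, G.Adj a b → G.Adj b c → G.Adj c d → G.Adj d a → a ≠ c → b ≠ d →
    G.Adj a c ∨ G.Adj b d
  c5 : ∀ a b c d e, G.Adj a b → G.Adj b c → G.Adj c d → G.Adj d e → G.Adj e a →
    a ≠ c → b ≠ d → c ≠ e → d ≠ a → e ≠ b →
    G.Adj a c ∨ G.Adj b d ∨ G.Adj c e ∨ G.Adj d a ∨ G.Adj e b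
  even : ∀ u z p q N s, 2 ≤ N → (N = 2 * s ∨ N = 2 * s + 1) → G.dist u z = N →
    G.Reachable u p → G.Reachable u q →
    G.dist u p = s → G.dist p z = N - s → G.dist u q = N - s → G.dist q z = s →
    G.dist p q < N
  odd : ∀ u v w p q n s t, 2 ≤ n → n = s + t → G.dist u v = n → G.dist u w = n → G.Adj v w →
    (∀ x, G.Adj x v → G.Adj x w → G.dist u x + 1 ≠ n) →
    G.Reachable u p → G.Reachable u q →
    G.dist u p = s → G.dist p v = t → G.dist u q = s → G.dist q w = t → G.dist p q < n

theorem adj_level_le {u v w : V} {n : ℕ} (h : G.Adj v w) (hv : G.dist u v = n) :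
    G.dist u w ≤ n + 1 ∧ n ≤ G.dist u w + 1 := by
  have h1 := dist_adj_le (u := u) h
  have h2 := dist_adj_le (u := u) h.symm
  omega

theorem inc_step (hM : MetricInput G) (n : ℕ) (hI : ∀ m, m < n → INC G m)
    (hT : ∀ m, m < n → TCond G m) : INC G n := by
  intro u z v w hz hv hw hdv hdw
  by_cases hvw : v = w
  · exact Or.inl hvw
  right
  have hrz : G.Reachable u z := SimpleGraph.Reachable.of_dist_ne_zero (by omega)
  have hrv : G.Reachable u v := hrz.trans hv.reachable
  have hrw : G.Reachable u w := hrz.trans hw.reachable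
  cases n with
  | zero =>
    have e1 := hrv.dist_eq_zero_iff.1 hdv
    have e2 := hrw.dist_eq_zero_iff.1 hdw
    exact absurd (e1.symm.trans e2) hvw
  | succ n =>
  -- local convexity of the ball
  have hloc : ∀ a b c x, a ∈ {t | G.dist u t ≤ n + 1 ∧ G.Reachable u t} →
      b ∈ {t | G.dist u t ≤ n + 1 ∧ G.Reachable u t} →
      c ∈ {t | G.dist u t ≤ n + 1 ∧ G.Reachable u t} →
      x ∉ {t | G.dist u t ≤ n + 1 ∧ G.Reachable u t} → G.Adj a b → G.Adj b c →
      G.Adj x a → G.Adj x b → G.Adj x c → a = c ∨ G.Adj a c := by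
    rintro a b c x ⟨ha, hra⟩ ⟨hb, hrb⟩ ⟨hc, hrc⟩ hx hab hbc hxa hxb hxc
    have hrx : G.Reachable u x := hra.trans hxa.symm.reachable
    have hx' : n + 1 < G.dist u x := by
      by_contra hcon
      exact hx ⟨by omega, hrx⟩
    have := dist_adj_le (u := u) hxa.symm
    have := dist_adj_le (u := u) hxb.symm
    have := dist_adj_le (u := u) hxc.symm
    obtain ⟨e, he1, he2, he3⟩ := hT n (by omega) u a b (by omega) (by omega) hab
    obtain ⟨f, hf1, hf2, hf3⟩ := hT n (by omega) u b c (by omega) (by omega) hbc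
    by_cases hac : a = c
    · exact Or.inl hac
    right
    have nox : ∀ t, G.dist u t = n → ¬ G.Adj t x ∧ t ≠ x := by
      intro t ht
      constructor
      · intro h
        have := dist_adj_le (u := u) h
        omega
      · rintro rfl; omega
    have hnb : ∀ t s, G.dist u t = n → G.dist u s = n + 1 → t ≠ s := by
      rintro t s h1 h2 rfl; omega
    have four : ∀ t, G.dist u t = n → G.Adj a t → G.Adj t c → G.Adj a c := by
      intro t ht h1 h2
      rcases hM.c4 a t c x h1 h2 hxc.symm hxa hac (nox t ht).2 with h | h
      · exact h
      · exact absurd h (nox t ht).1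
    rcases hI n (by omega) u b e f (by omega) he2.symm hf1.symm he3 hf3 with rfl | hef
    · exact four e he3 he1.symm hf2
    · rcases hM.c5 a e f c x he1.symm hef hf2 hxc.symm hxa
        (hnb f a hf3 (by omega)).symm (hnb e c he3 (by omega)) (nox f hf3).2 (Ne.symm hac)
        (nox e he3).2.symm with h | h | h | h | h
      · exact four f hf3 h hf2
      · exact four e he3 he1.symm h
      · exact absurd h (nox f hf3).1
      · exact h.symm
      · exact absurd h.symm (nox e he3).1
  -- shortcut
  obtain ⟨s, hs⟩ : ∃ s, n + 2 = 2 * s ∨ n + 2 = 2 * s + 1 := ⟨(n + 2) / 2, by omega⟩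
  obtain ⟨p, hp1, hp2, hp3⟩ := exists_mid hrv s (n + 1 - s) (by omega)
  obtain ⟨q, hq1, hq2, hq3⟩ := exists_mid hrw (n + 2 - s) (s - 1) (by omega)
  have hpz : G.dist p z = n + 2 - s := by
    have h1 := dist_adj_le (u := p) hv.symm
    have h2 := hp3.dist_triangle_left z
    omega
  have hqz : G.dist q z = s := by
    have h1 := dist_adj_le (u := q) hw.symm
    have h2 := hq3.dist_triangle_left z
    omega
  have hpq := hM.even u z p q (n + 2) s (by omega) hs hz hp3 hq3 hp1 hpz hq1 hqz
  set B : Set V := {t | G.dist u t ≤ n + 1 ∧ G.Reachable u t} with hB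
  have r1 : Rch G B p (n + 1 - s) v := by
    apply geoB _ (hp3.symm.trans hrv) hp2
    intro t ht1 ht2
    have h2 := hp3.dist_triangle_left t
    exact ⟨by omega, hp3.trans ht1⟩
  have r2 : Rch G B q (s - 1) w := by
    apply geoB _ (hq3.symm.trans hrw) hq2
    intro t ht1 ht2
    have h2 := hq3.dist_triangle_left t
    exact ⟨by omega, hq3.trans ht1⟩
  have r3 : Rch G B p (G.dist p q) q := by
    apply geoB _ (hp3.symm.trans hq3) rfl
    intro t ht1 ht2
    have h1 := hp3.dist_triangle_left t
    have h2 := hq3.dist_triangle_left t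
    rw [G.dist_comm (u := q)] at h2
    exact ⟨by omega, hp3.trans ht1⟩
  have r4 := (r1.symm.trans r3).trans r2
  have hd2 : G.dist v w ≤ 2 := by
    have := dist_adj_le (u := v) hw
    have := SimpleGraph.dist_eq_one_iff_adj.2 hv.symm
    omega
  have r5 := straightB (ℓ := 2 * n + 4) (fun m hm => hI m (by omega))
    (fun m hm => hT m (by omega)) hloc _ r4 (by omega)
  have hd0 : G.dist v w ≠ 0 := by
    intro h
    exact hvw ((hrv.symm.trans hrw).dist_eq_zero_iff.1 h)
  obtain h1 | h2 : G.dist v w = 1 ∨ G.dist v w = 2 := by omega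
  · exact SimpleGraph.dist_eq_one_iff_adj.1 h1
  · rw [h2] at r5
    obtain ⟨b, ⟨a, ⟨rfl, ha⟩, hab, hbB⟩, hbw, hwB⟩ := r5
    by_cases hb : G.Adj b z
    · have hz' : z ∉ B := fun h => by have := h.1; omega
      rcases hloc a b w z ha hbB hwB hz' hab hbw hv hb.symm hw with h | h
      · exact absurd h hvw
      · exact h
    · rcases hM.c4 a b w z hab hbw hw.symm hv hvw (by rintro rfl; have := hbB.1; omega) with h | h
      · exact h
      · exact absurd h hb

theorem tc_step (hM : MetricInput G) (n : ℕ) (hI : ∀ m, m ≤ n → INC G m)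
    (hT : ∀ m, m < n → TCond G m) : TCond G n := by
  intro u v w hdv hdw hvw
  by_contra hno
  have hno' : ∀ x, G.Adj x v → G.Adj x w → G.dist u x ≤ n → False := by
    intro x h1 h2 h3
    apply hno
    have := dist_adj_le (u := u) h1
    exact ⟨x, h1, h2, by omega⟩
  have hrv : G.Reachable u v := SimpleGraph.Reachable.of_dist_ne_zero (by omega)
  have hrw : G.Reachable u w := SimpleGraph.Reachable.of_dist_ne_zero (by omega)
  cases n with
  | zero =>
    exact hno' u (SimpleGraph.dist_eq_one_iff_adj.1 hdv)
      (SimpleGraph.dist_eq_one_iff_adj.1 hdw) (by simp)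
  | succ n =>
  obtain ⟨s, hs⟩ : ∃ s, n + 2 = 2 * s ∨ n + 3 = 2 * s := ⟨(n + 3) / 2, by omega⟩
  obtain ⟨p, hp1, hp2, hp3⟩ := exists_mid hrv s (n + 2 - s) (by omega)
  obtain ⟨q, hq1, hq2, hq3⟩ := exists_mid hrw s (n + 2 - s) (by omega)
  have hpq := hM.odd u v w p q (n + 2) s (n + 2 - s) (by omega) (by omega) hdv hdw hvw
    (fun x h1 h2 h3 => hno' x h1 h2 (by omega)) hp3 hq3 hp1 hp2 hq1 hq2
  obtain ⟨v', hv1, hv2, hv3⟩ := exists_pred (G := G) (u := p) (w := v) (k := n + 1 - s) (by omega)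
  obtain ⟨w', hw1, hw2, hw3⟩ := exists_pred (G := G) (u := q) (w := w) (k := n + 1 - s) (by omega)
  set B : Set V := {t | G.dist u t ≤ n + 1 ∧ G.Reachable u t} with hB
  have hloc : ∀ a b c x, a ∈ B → b ∈ B → c ∈ B → x ∉ B → G.Adj a b → G.Adj b c →
      G.Adj x a → G.Adj x b → G.Adj x c → a = c ∨ G.Adj a c := by
    rintro a b c x ⟨ha, hra⟩ ⟨hb, hrb⟩ ⟨hc, hrc⟩ hx hab hbc hxa hxb hxc
    have hrx : G.Reachable u x := hra.trans hxa.symm.reachable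
    have hx' : n + 1 < G.dist u x := by
      by_contra hcon
      exact hx ⟨by omega, hrx⟩
    have := dist_adj_le (u := u) hxa.symm
    have := dist_adj_le (u := u) hxc.symm
    exact hI (n + 1) le_rfl u x a c (by omega) hxa hxc (by omega) (by omega)
  have r1 : Rch G B p (n + 1 - s) v' := by
    apply geoB _ hv3 hv2
    intro t ht1 ht2
    have h2 := hp3.dist_triangle_left t
    exact ⟨by omega, hp3.trans ht1⟩
  have r2 : Rch G B q (n + 1 - s) w' := by
    apply geoB _ hw3 hw2
    intro t ht1 ht2
    have h2 := hq3.dist_triangle_left t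
    exact ⟨by omega, hq3.trans ht1⟩
  have r3 : Rch G B p (G.dist p q) q := by
    apply geoB _ (hp3.symm.trans hq3) rfl
    intro t ht1 ht2
    have h1 := hp3.dist_triangle_left t
    have h2 := hq3.dist_triangle_left t
    rw [G.dist_comm (u := q)] at h2
    refine ⟨?_, hp3.trans ht1⟩
    by_contra hcon
    have hut : G.dist u t = n + 2 := by omega
    have hpt : G.dist p t = (n + 1 - s) + 1 := by omega
    have htq : G.dist q t = (n + 1 - s) + 1 := by rw [G.dist_comm]; omega
    obtain ⟨y, hy1, hy2, hy3⟩ := exists_pred hpt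
    obtain ⟨y', hy1', hy2', hy3'⟩ := exists_pred htq
    have e1 := hp3.dist_triangle_left y
    have e2 := hq3.dist_triangle_left y'
    have e3 := dist_adj_le (u := u) hy1
    have e4 := dist_adj_le (u := u) hy1'
    have e5 := hy3.dist_triangle_left q
    have e6 : G.dist y q ≤ n + 2 - s := by
      rcases hI (n + 1) le_rfl u t y y' hut hy1.symm hy1'.symm (by omega) (by omega) with rfl | h
      · rw [G.dist_comm]; omega
      · have := dist_adj_le (u := q) h.symm
        rw [G.dist_comm]; omega
    omega
  have r4 := (r1.symm.trans r3).trans r2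
  have hv'u : G.dist u v' ≤ n + 1 := r1.mem.1
  have hw'u : G.dist u w' ≤ n + 1 := r2.mem.1
  have hd3 : G.dist v' w' ≤ 3 := by
    have := dist_adj_le (u := v') hw1.symm
    have := dist_adj_le (u := v') hvw
    have := SimpleGraph.dist_eq_one_iff_adj.2 hv1
    omega
  have r5 := straightB (ℓ := 2 * n + 5) (fun m hm => hI m (by omega))
    (fun m hm => hT m (by omega)) hloc _ r4 (by omega)
  have hne : ∀ t, G.dist u t ≤ n + 1 → t ≠ v ∧ t ≠ w := by
    intro t ht
    constructor <;> · rintro rfl; omega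
  have four : ∀ a b, G.dist u a ≤ n + 1 → G.dist u b ≤ n + 1 → G.Adj v a → G.Adj a b →
      G.Adj b w → False := by
    intro a b ha hb h1 h2 h3
    rcases hM.c4 v a b w h1 h2 h3 hvw.symm (hne b hb).1.symm (hne a ha).2 with h | h
    · exact hno' b h.symm h3 hb
    · exact hno' a h1.symm h ha
  obtain h | h | h | h : G.dist v' w' = 0 ∨ G.dist v' w' = 1 ∨ G.dist v' w' = 2 ∨
    G.dist v' w' = 3 := by omega
  · have : v' = w' := r4.reach.dist_eq_zero_iff.1 h
    subst this
    exact hno' v' hv1 hw1 hv'u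
  · exact four v' w' hv'u hw'u hv1.symm (SimpleGraph.dist_eq_one_iff_adj.1 h) hw1
  · rw [h] at r5
    obtain ⟨b, ⟨a, ⟨rfl, ha⟩, hab, hbB⟩, hbw, hwB⟩ := r5
    have hbu := hbB.1
    have hnaw : a ≠ w' := by rintro rfl; simp at h
    rcases hM.c5 v a b w' w hv1.symm hab hbw hw1 hvw.symm (hne b hbu).1.symm
      hnaw (hne b hbu).2 (hne w' hw'u).1 (hne a hv'u).2.symm with h' | h' | h' | h' | h'
    · exact four b w' hbu hw'u h' hbw hw1
    · have := SimpleGraph.dist_eq_one_iff_adj.2 h'; omega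
    · exact four a b hv'u hbu hv1.symm hab h'
    · exact hno' w' h' hw1 hw'u
    · exact hno' a hv1 h'.symm hv'u
  · have hn : 1 ≤ n := by
      by_contra hn
      have h1 := hrv.symm.trans hrw
      have e1 : G.Reachable u v' := r1.mem.2
      have := e1.symm.dist_triangle_left w'
      rw [G.dist_comm (u := v') (v := u)] at this
      omega
    rw [h] at r5
    obtain ⟨c, ⟨b, ⟨a, ⟨rfl, ha⟩, hab, hbB⟩, hbc, hcB⟩, hcw, hwB⟩ := r5
    have d1 : G.dist a v = 1 := SimpleGraph.dist_eq_one_iff_adj.2 hv1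
    have d1' : G.dist w' w = 1 := SimpleGraph.dist_eq_one_iff_adj.2 hw1
    have d2 := dist_adj_le (u := a) hvw
    have d2' := dist_adj_le (u := w') hvw.symm
    have d3 := dist_adj_le (u := a) hw1.symm
    have d3' := dist_adj_le (u := w') hv1.symm
    have d4 : G.dist a b = 1 := SimpleGraph.dist_eq_one_iff_adj.2 hab
    have d4' : G.dist w' c = 1 := SimpleGraph.dist_eq_one_iff_adj.2 hcw.symm
    have d5 := dist_adj_le (u := a) hbc
    have d5' := dist_adj_le (u := w') hbc.symm
    have d6 := dist_adj_le (u := a) hcw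
    have d6' := dist_adj_le (u := w') hab.symm
    have h' : G.dist w' a = 3 := by rw [G.dist_comm]; exact h
    have f1 : G.Adj c w := by
      rcases hI 2 (by omega) a w' c w h hcw.symm hw1 (by omega) (by omega) with e | e
      · exact absurd e (hne c hcB.1).2
      · exact e
    have f2 : G.Adj b v := by
      rcases hI 2 (by omega) w' a b v h' hab hv1 (by omega) (by omega) with e | e
      · exact absurd e (hne b hbB.1).1
      · exact e
    exact four b c hbB.1 hcB.1 f2.symm hbc f1

theorem inc_tc (hM : MetricInput G) (n : ℕ) : INC G n ∧ TCond G n := by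
  induction n using Nat.strong_induction_on with
  | _ n ih =>
    have h1 : INC G n := inc_step hM n (fun m hm => (ih m hm).1) (fun m hm => (ih m hm).2)
    refine ⟨h1, tc_step hM n (fun m hm => ?_) (fun m hm => (ih m hm).2)⟩
    rcases hm.lt_or_eq with h | rfl
    · exact (ih m h).1
    · exact h1

end Combi2

section AbstractMetric

/-- A geodesic-midpoint pseudometric with the CN inequality. -/
structure CN0 {X : Type*} (d : X → X → ℝ) : Prop where
  symm : ∀ x y, d x y = d y x
  nonneg : ∀ x y, 0 ≤ d x y
  tri : ∀ x y z, d x z ≤ d x y + d y z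
  mid : ∀ x y, ∃ m, d x m = d x y / 2 ∧ d m y = d x y / 2
  cn : ∀ x y z m, d y m = d y z / 2 → d m z = d y z / 2 →
    d x m ^ 2 ≤ d x y ^ 2 / 2 + d x z ^ 2 / 2 - d y z ^ 2 / 4

/-- Twice the quasi inner product. -/
def qip {X : Type*} (d : X → X → ℝ) (a b c e : X) : ℝ :=
  d a e ^ 2 + d b c ^ 2 - d a c ^ 2 - d b e ^ 2

variable {X : Type*} {d : X → X → ℝ}

theorem CN0.quad (h : CN0 d) (a b c e : X) : qip d a b c e ≤ d a b ^ 2 + d c e ^ 2 := by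
  obtain ⟨m, h1, h2⟩ := h.mid a e
  have e1 := h.cn b a e m h1 h2
  have e2 := h.cn c a e m h1 h2
  have e3 := h.tri b m c
  rw [h.symm m c] at e3
  have e4 := h.nonneg b c
  have e5 : d b c ^ 2 ≤ 2 * d b m ^ 2 + 2 * d c m ^ 2 := by
    nlinarith [sq_nonneg (d b m - d c m), h.nonneg b m, h.nonneg c m]
  unfold qip
  rw [h.symm a b, h.symm a c]
  linarith

theorem qip_add_left (a m b c e : X) : qip d a b c e = qip d a m c e + qip d m b c e := by
  unfold qip; ring

theorem qip_add_right (a b c m e : X) : qip d a b c e = qip d a b c m + qip d a b m e := by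
  unfold qip; ring

theorem CN0.quad_half (h : CN0 d) (r : ℝ)
    (hr : ∀ a b c e, qip d a b c e ≤ r * d a b ^ 2 + d c e ^ 2 / r) (a b c e : X) :
    qip d a b c e ≤ (r / 2) * d a b ^ 2 + d c e ^ 2 / (r / 2) := by
  obtain ⟨m, h1, h2⟩ := h.mid a b
  have e1 := hr a m c e
  have e2 := hr m b c e
  rw [qip_add_left a m b c e]
  rw [h1] at e1
  rw [h2] at e2
  have : d c e ^ 2 / (r / 2) = d c e ^ 2 / r + d c e ^ 2 / r := by
    rw [div_div_eq_mul_div]; ring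
  rw [this]
  nlinarith

theorem CN0.quad_eighth (h : CN0 d) (a b c e : X) :
    qip d a b c e ≤ (1 / 8) * d a b ^ 2 + 8 * d c e ^ 2 := by
  have h1 := h.quad_half 1 (fun a b c e => by simpa using h.quad a b c e)
  have h2 := h.quad_half _ h1
  have h3 := h.quad_half _ h2 a b c e
  norm_num at h3 ⊢
  linarith

theorem CN0.path_right (h : CN0 d) (a b : X) (C D : ℝ) (y : ℕ → X) (l : ℕ)
    (hq : ∀ i < l, qip d a b (y i) (y (i + 1)) ≤ C) :
    qip d a b (y 0) (y l) ≤ l * C := by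
  induction l with
  | zero => simp [qip]
  | succ l ih =>
    rw [qip_add_right a b (y 0) (y l) (y (l + 1))]
    have := ih (fun i hi => hq i (by omega))
    have := hq l (by omega)
    push_cast
    linarith

theorem CN0.path_left (h : CN0 d) (c e : X) (C : ℝ) (x : ℕ → X) (l : ℕ)
    (hq : ∀ i < l, qip d (x i) (x (i + 1)) c e ≤ C) :
    qip d (x 0) (x l) c e ≤ l * C := by
  induction l with
  | zero => simp [qip]
  | succ l ih =>
    rw [qip_add_left (x 0) (x l) (x (l + 1))]
    have := ih (fun i hi => hq i (by omega))
    have := hq l (by omega)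
    push_cast
    linarith

theorem CN0.paths (h : CN0 d) (x y : ℕ → X) (k l : ℕ) (δ : ℝ)
    (hx : ∀ i < k, d (x i) (x (i + 1)) ≤ δ) (hy : ∀ i < l, d (y i) (y (i + 1)) ≤ δ) :
    qip d (x 0) (x k) (y 0) (y l) ≤ k * (l * (2 * δ ^ 2)) := by
  apply h.path_left
  intro i hi
  apply h.path_right _ _ _ 0
  intro j hj
  have := h.quad (x i) (x (i + 1)) (y j) (y (j + 1))
  have e1 := pow_le_pow_left₀ (h.nonneg _ _) (hx i hi) 2
  have e2 := pow_le_pow_left₀ (h.nonneg _ _) (hy j hj) 2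
  linarith

theorem CN0.path_dist (h : CN0 d) (h0 : ∀ x, d x x = 0) (x : ℕ → X) (k : ℕ) (δ : ℝ)
    (hx : ∀ i < k, d (x i) (x (i + 1)) ≤ δ) : d (x 0) (x k) ≤ k * δ := by
  induction k with
  | zero => simp [h0]
  | succ k ih =>
    have := ih (fun i hi => hx i (by omega))
    have := hx k (by omega)
    have := h.tri (x 0) (x k) (x (k + 1))
    push_cast
    linarith

end AbstractMetric

section PDist

variable {V : Type*} [DecidableEq V]

/-- Chains, as an inductive predicate. -/
inductive ChCon (K : SC V) : (V →₀ ℝ) → (V →₀ ℝ) → ℝ → Prop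
  | refl (x : V →₀ ℝ) (hx : K.IsPoint x) : ChCon K x x 0
  | cons (x y z : V →₀ ℝ) (L : ℝ) (hx : K.IsPoint x) (hxy : K.SameCell x y) (h : ChCon K y z L) :
      ChCon K x z (stepD x y + L)

variable {K : SC V}

theorem con_of_chain : ∀ (c : List (V →₀ ℝ)) (x y : V →₀ ℝ), K.IsChain c → c.head? = some x →
    c.getLast? = some y → ChCon K x y (chLen c) := by
  intro c
  induction c with
  | nil => intro x y _ h; simp at h
  | cons a c ih =>
    intro x y hc hx hy
    simp only [List.head?_cons, Option.some.injEq] at hx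
    subst hx
    cases c with
    | nil =>
      simp only [List.getLast?_singleton, Option.some.injEq] at hy
      subst hy
      have : chLen [a] = 0 := by simp [chLen]
      rw [this]
      exact ChCon.refl a (hc.1 a (by simp))
    | cons b c =>
      have hl : chLen (a :: b :: c) = stepD a b + chLen (b :: c) := by simp [chLen]
      rw [hl]
      have h2 : K.SameCell a b ∧ List.IsChain K.SameCell (b :: c) := by
        have := hc.2
        exact List.isChain_cons_cons.1 this
      refine ChCon.cons a b y _ (hc.1 a (by simp)) h2.1 (ih b y ⟨?_, h2.2⟩ rfl ?_)
      · intro z hz; exact hc.1 z (by simp only [List.mem_cons] at hz ⊢; right; exact hz)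
      · rw [← hy]; simp [List.getLast?_cons_cons]

theorem chain_of_con {x y : V →₀ ℝ} {L : ℝ} (h : ChCon K x y L) :
    ∃ c, K.IsChain c ∧ c.head? = some x ∧ c.getLast? = some y ∧ chLen c = L := by
  induction h with
  | refl x hx =>
    refine ⟨[x], ⟨by simpa using hx, ?_⟩, rfl, rfl, by simp [chLen]⟩
    exact List.isChain_singleton x
  | cons x y z L hx hxy _ ih =>
    obtain ⟨c, h1, h2, h3, h4⟩ := ih
    cases c with
    | nil => simp at h2
    | cons b c =>
      simp only [List.head?_cons, Option.some.injEq] at h2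
      subst h2
      refine ⟨x :: b :: c, ⟨?_, ?_⟩, rfl, ?_, ?_⟩
      · intro t ht
        rcases List.mem_cons.1 ht with rfl | ht
        · exact hx
        · exact h1.1 t ht
      · exact List.isChain_cons_cons.2 ⟨hxy, h1.2⟩
      · rw [← h3]; simp [List.getLast?_cons_cons]
      · rw [← h4]; simp [chLen]

theorem pdist_eq (x y : V →₀ ℝ) : K.pdist x y = sInf {L | ChCon K x y L} := by
  unfold SC.pdist
  congr 1
  ext L
  constructor
  · rintro ⟨c, h1, h2, h3, rfl⟩
    exact con_of_chain c x y h1 h2 h3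
  · exact chain_of_con

theorem stepD_comm (x y : V →₀ ℝ) : stepD x y = stepD y x := by
  unfold stepD
  have : y - x = -(x - y) := by abel
  rw [this, Finsupp.sum_neg_index (by simp)]
  simp

theorem stepD_nonneg (x y : V →₀ ℝ) : 0 ≤ stepD x y := Real.sqrt_nonneg _

theorem ChCon.left {x y : V →₀ ℝ} {L : ℝ} (h : ChCon K x y L) : K.IsPoint x := by
  cases h <;> assumption

theorem ChCon.right {x y : V →₀ ℝ} {L : ℝ} (h : ChCon K x y L) : K.IsPoint y := by
  induction h <;> assumption

theorem ChCon.nonneg {x y : V →₀ ℝ} {L : ℝ} (h : ChCon K x y L) : 0 ≤ L := by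
  induction h with
  | refl => exact le_rfl
  | cons x y z L _ _ _ ih => have := stepD_nonneg x y; linarith

theorem ChCon.trans {x y z : V →₀ ℝ} {L M : ℝ} (h : ChCon K x y L) (h' : ChCon K y z M) :
    ChCon K x z (L + M) := by
  induction h with
  | refl => simpa using h'
  | cons x y w L hx hxy _ ih =>
    rw [add_assoc]
    exact ChCon.cons _ _ _ _ hx hxy (ih h')

theorem ChCon.symm {x y : V →₀ ℝ} {L : ℝ} (h : ChCon K x y L) : ChCon K y x L := by
  induction h with
  | refl x hx => exact ChCon.refl x hx
  | cons x y z L hx hxy h ih =>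
    have : ChCon K y x (stepD y x + 0) := by
      refine ChCon.cons _ _ _ _ h.left ?_ (ChCon.refl x hx)
      unfold SC.SameCell at *
      rwa [Finset.union_comm]
    rw [stepD_comm, add_comm]
    simpa using ih.trans this

theorem con_bdd (x y : V →₀ ℝ) : BddBelow {L | ChCon K x y L} := ⟨0, fun _ h => ChCon.nonneg h⟩

theorem pdist_le {x y : V →₀ ℝ} {L : ℝ} (h : ChCon K x y L) : K.pdist x y ≤ L := by
  rw [pdist_eq]
  exact csInf_le (con_bdd x y) h

theorem pdist_le_step {x y : V →₀ ℝ} (hx : K.IsPoint x) (hy : K.IsPoint y)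
    (h : K.SameCell x y) : K.pdist x y ≤ stepD x y := by
  have := pdist_le (ChCon.cons x y y 0 hx h (ChCon.refl y hy))
  simpa using this

theorem pdist_nonneg (x y : V →₀ ℝ) : 0 ≤ K.pdist x y := by
  rw [pdist_eq]
  exact Real.sInf_nonneg (fun L h => ChCon.nonneg h)

theorem pdist_comm (x y : V →₀ ℝ) : K.pdist x y = K.pdist y x := by
  rw [pdist_eq, pdist_eq]
  congr 1
  ext L
  exact ⟨ChCon.symm, ChCon.symm⟩

theorem pdist_self {x : V →₀ ℝ} (hx : K.IsPoint x) : K.pdist x x = 0 :=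
  le_antisymm (pdist_le (ChCon.refl x hx)) (pdist_nonneg x x)

theorem con_exists (hK : K.IsCAT0) {x y : V →₀ ℝ} (hx : K.IsPoint x) (hy : K.IsPoint y) :
    {L | ChCon K x y L}.Nonempty := by
  obtain ⟨c, h1, h2, h3⟩ := hK.2.1 x y hx hy
  exact ⟨_, con_of_chain c x y h1 h2 h3⟩

theorem pdist_tri (hK : K.IsCAT0) {x y z : V →₀ ℝ} (hx : K.IsPoint x) (hy : K.IsPoint y)
    (hz : K.IsPoint z) : K.pdist x z ≤ K.pdist x y + K.pdist y z := by
  have h1 : K.pdist x z - K.pdist x y ≤ K.pdist y z := by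
    rw [pdist_eq y z]
    refine le_csInf (con_exists hK hy hz) ?_
    intro M hM
    have : K.pdist x z - M ≤ K.pdist x y := by
      rw [pdist_eq x y]
      refine le_csInf (con_exists hK hx hy) ?_
      intro L hL
      have := pdist_le (ChCon.trans hL hM)
      linarith
    linarith
  linarith

/-- A function which is 1-Lipschitz on cells is 1-Lipschitz. -/
theorem lip_le (hK : K.IsCAT0) (Ψ : (V →₀ ℝ) → ℝ)
    (hΨ : ∀ x y, K.IsPoint x → K.IsPoint y → K.SameCell x y → Ψ y - Ψ x ≤ stepD x y)
    {x y : V →₀ ℝ} (hx : K.IsPoint x) (hy : K.IsPoint y) : Ψ y - Ψ x ≤ K.pdist x y := by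
  rw [pdist_eq]
  refine le_csInf (con_exists hK hx hy) ?_
  intro L hL
  have hL' : ChCon K x y L := hL
  clear hL
  induction hL' with
  | refl => simp
  | cons x y z L hx' hxy h ih =>
    have := hΨ x y hx' h.left hxy
    have := ih h.left hy
    linarith

/-- The points of the realization. -/
abbrev PtK (K : SC V) : Type _ := {x : V →₀ ℝ // K.IsPoint x}

theorem cn0 (hK : K.IsCAT0) : CN0 (fun x y : PtK K => K.pdist x.1 y.1) where
  symm x y := pdist_comm _ _
  nonneg x y := pdist_nonneg _ _
  tri x y z := pdist_tri hK x.2 y.2 z.2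
  mid x y := by
    obtain ⟨m, h1, h2, h3⟩ := hK.2.2.1 x.1 y.1 x.2 y.2
    exact ⟨⟨m, h1⟩, h2, h3⟩
  cn x y z m h1 h2 := hK.2.2.2 x.1 y.1 z.1 m.1 x.2 y.2 z.2 m.2 h1 h2

end PDist

section CellGeom

variable {V : Type*} [DecidableEq V] {K : SC V}

theorem stepD_sq' (x y : V →₀ ℝ) :
    stepD x y ^ 2 = (∑ v ∈ x.support ∪ y.support, (x v - y v) ^ 2) / 2 := by
  unfold stepD
  rw [Real.sq_sqrt]
  · congr 1
    rw [Finsupp.sum_of_support_subset (s := x.support ∪ y.support)]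
    · rfl
    · intro v hv
      simp only [Finsupp.mem_support_iff, Finsupp.sub_apply, ne_eq, Finset.mem_union] at *
      by_contra h
      push Not at h
      exact hv (by rw [h.1, h.2, sub_zero])
    · simp
  · apply div_nonneg _ (by norm_num)
    exact Finset.sum_nonneg (fun i _ => sq_nonneg _)

theorem point_sum {x : V →₀ ℝ} (hx : K.IsPoint x) {σ : Finset V} (h : x.support ⊆ σ) :
    ∑ v ∈ σ, x v = 1 := by
  rw [← hx.2.1, Finsupp.sum_of_support_subset (s := σ) _ h]
  simp

theorem cellCS {x y : V →₀ ℝ} (hx : K.IsPoint x) (hy : K.IsPoint y) (c : V → ℝ) (k C : ℝ)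
    (hC : ∑ v ∈ x.support ∪ y.support, (c v - k) ^ 2 ≤ C) :
    (∑ v ∈ x.support ∪ y.support, x v * c v - ∑ v ∈ x.support ∪ y.support, y v * c v) ^ 2
      ≤ 2 * C * stepD x y ^ 2 := by
  have h1 := point_sum hx (Finset.subset_union_left (s₁ := x.support) (s₂ := y.support))
  have h2 := point_sum hy (Finset.subset_union_right (s₁ := x.support) (s₂ := y.support))
  have h3 : ∑ v ∈ x.support ∪ y.support, x v * c v - ∑ v ∈ x.support ∪ y.support, y v * c v
      = ∑ v ∈ x.support ∪ y.support, (x v - y v) * (c v - k) := by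
    have : ∀ v, (x v - y v) * (c v - k) = x v * c v - y v * c v - k * x v + k * y v := by
      intro v; ring
    simp only [this, Finset.sum_add_distrib, Finset.sum_sub_distrib, ← Finset.mul_sum, h1, h2]
    ring
  rw [h3, stepD_sq']
  have h4 := Finset.sum_mul_sq_le_sq_mul_sq (x.support ∪ y.support) (fun v => x v - y v)
    (fun v => c v - k)
  have h5 : 0 ≤ ∑ v ∈ x.support ∪ y.support, (x v - y v) ^ 2 :=
    Finset.sum_nonneg (fun i _ => sq_nonneg _)
  nlinarith

/-- Linear function bound on a cell, values in a unit interval. -/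
theorem cell_lin (h3 : K.Is3Dim) {x y : V →₀ ℝ} (hx : K.IsPoint x) (hy : K.IsPoint y)
    (hxy : K.SameCell x y) (c : V → ℝ) (k : ℝ)
    (hc : ∀ v ∈ x.support ∪ y.support, k ≤ c v ∧ c v ≤ k + 1) :
    (∑ v ∈ x.support ∪ y.support, x v * c v - ∑ v ∈ x.support ∪ y.support, y v * c v) ^ 2
      ≤ 2 * stepD x y ^ 2 := by
  have h := cellCS hx hy c (k + 1 / 2) 1 ?_
  · linarith
  · calc ∑ v ∈ x.support ∪ y.support, (c v - (k + 1 / 2)) ^ 2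
        ≤ ∑ v ∈ x.support ∪ y.support, (1 / 4 : ℝ) := by
          refine Finset.sum_le_sum fun v hv => ?_
          obtain ⟨h1, h2⟩ := hc v hv
          nlinarith
      _ = ((x.support ∪ y.support).card : ℝ) * (1 / 4) := by simp
      _ ≤ 1 := by
          have : ((x.support ∪ y.support).card : ℝ) ≤ 4 := by exact_mod_cast h3 _ hxy
          linarith

theorem coord_eq (x : V →₀ ℝ) (σ : Finset V) (h : x.support ⊆ σ) (a : V) :
    ∑ v ∈ σ, x v * (if v = a then 1 else 0) = x a := by
  simp only [mul_ite, mul_one, mul_zero, Finset.sum_ite_eq']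
  by_cases ha : a ∈ σ
  · simp [ha]
  · have : a ∉ x.support := fun h' => ha (h h')
    simp only [Finsupp.mem_support_iff, ne_eq, not_not] at this
    simp [ha, this]

theorem cell_coord (h3 : K.Is3Dim) {x y : V →₀ ℝ} (hx : K.IsPoint x) (hy : K.IsPoint y)
    (hxy : K.SameCell x y) (a : V) : (x a - y a) ^ 2 ≤ 3 / 2 * stepD x y ^ 2 := by
  by_cases ha : a ∈ x.support ∪ y.support
  · have h := cellCS hx hy (fun v => if v = a then 1 else 0) (1 / 4) (3 / 4) ?_
    · rw [coord_eq x _ Finset.subset_union_left, coord_eq y _ Finset.subset_union_right] at h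
      linarith
    · rw [← Finset.add_sum_erase _ _ ha]
      have : ∑ v ∈ (x.support ∪ y.support).erase a, ((if v = a then 1 else 0) - (1 / 4 : ℝ)) ^ 2
          = ((x.support ∪ y.support).erase a).card * (1 / 16 : ℝ) := by
        rw [Finset.sum_congr rfl (g := fun _ => (1 / 16 : ℝ))]
        · simp
        · intro v hv
          rw [if_neg (Finset.ne_of_mem_erase hv)]; norm_num
      rw [this]
      have h4 : (((x.support ∪ y.support).erase a).card : ℝ) ≤ 3 := by
        have h5 := h3 _ hxy
        rw [Finset.card_erase_of_mem ha]
        exact_mod_cast (by omega : (x.support ∪ y.support).card - 1 ≤ 3)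
      norm_num
      linarith
  · simp only [Finset.mem_union, Finsupp.mem_support_iff, ne_eq, not_or, not_not] at ha
    rw [ha.1, ha.2]
    have := sq_nonneg (stepD x y)
    norm_num
    linarith

theorem cell_diff {x y : V →₀ ℝ} (hx : K.IsPoint x) (hy : K.IsPoint y)
    (v w : V) (hvw : v ≠ w) :
    ((x v - x w) / 2 - (y v - y w) / 2) ^ 2 ≤ stepD x y ^ 2 := by
  have key : ∀ z : V →₀ ℝ, z.support ⊆ x.support ∪ y.support →
      ∑ t ∈ x.support ∪ y.support, z t * (if t = v then 1 / 2 else if t = w then -1 / 2 else 0) =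
        (z v - z w) / 2 := by
    intro z hz
    rw [← coord_eq z _ hz v, ← coord_eq z _ hz w, ← Finset.sum_sub_distrib, Finset.sum_div]
    refine Finset.sum_congr rfl fun t _ => ?_
    by_cases h1 : t = v
    · subst h1; simp [hvw]; ring
    · by_cases h2 : t = w
      · subst h2; simp [h1]; ring
      · simp [h1, h2]
  have h := cellCS hx hy (fun t => if t = v then 1 / 2 else if t = w then -1 / 2 else 0) 0 (1 / 2) ?_
  · rw [key x Finset.subset_union_left, key y Finset.subset_union_right] at h
    linarith
  · calc _ ≤ ∑ t ∈ x.support ∪ y.support,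
          ((if t = v then (1 / 4 : ℝ) else 0) + (if t = w then 1 / 4 else 0)) := by
          refine Finset.sum_le_sum fun t _ => ?_
          by_cases h1 : t = v
          · subst h1; simp [hvw]; norm_num
          · by_cases h2 : t = w
            · subst h2; simp [h1]; norm_num
            · simp [h1, h2]
      _ ≤ 1 / 2 := by
          rw [Finset.sum_add_distrib, Finset.sum_ite_eq', Finset.sum_ite_eq']
          split_ifs <;> norm_num

/-- The constants. -/
theorem abs_le_of_sq {a s C A : ℝ} (hs : 0 ≤ s) (hA : 0 ≤ A) (hC : A ^ 2 * C = 1)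
    (h : a ^ 2 ≤ C * s ^ 2) : A * |a| ≤ s := by
  apply abs_le_of_sq_le_sq' _ hs |>.2
  rw [mul_pow, sq_abs]
  nlinarith [sq_nonneg A]

/-- sqrt(2/3). -/
noncomputable def cA : ℝ := Real.sqrt (2 / 3)
/-- sqrt(1/2). -/
noncomputable def cB : ℝ := Real.sqrt (1 / 2)

theorem cA_sq : cA ^ 2 = 2 / 3 := Real.sq_sqrt (by norm_num)
theorem cB_sq : cB ^ 2 = 1 / 2 := Real.sq_sqrt (by norm_num)
theorem cA_nonneg : 0 ≤ cA := Real.sqrt_nonneg _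
theorem cB_nonneg : 0 ≤ cB := Real.sqrt_nonneg _

theorem lipA (h3 : K.Is3Dim) {x y : V →₀ ℝ} (hx : K.IsPoint x) (hy : K.IsPoint y)
    (hxy : K.SameCell x y) (a : V) : cA * |x a - y a| ≤ stepD x y :=
  abs_le_of_sq (stepD_nonneg x y) cA_nonneg (C := 3 / 2) (by rw [cA_sq]; norm_num)
    (cell_coord h3 hx hy hxy a)

theorem lipMin (h3 : K.Is3Dim) {x y : V →₀ ℝ} (hx : K.IsPoint x) (hy : K.IsPoint y)
    (hxy : K.SameCell x y) (a b : V) : cA * |min (x a) (x b) - min (y a) (y b)| ≤ stepD x y := by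
  have h := abs_min_sub_min_le_max (x a) (x b) (y a) (y b)
  rcases le_total (|x a - y a|) (|x b - y b|) with h1 | h1
  · rw [max_eq_right h1] at h
    exact (mul_le_mul_of_nonneg_left h cA_nonneg).trans (lipA h3 hx hy hxy b)
  · rw [max_eq_left h1] at h
    exact (mul_le_mul_of_nonneg_left h cA_nonneg).trans (lipA h3 hx hy hxy a)

/-- The 1-skeleton. -/
def skel (K : SC V) : SimpleGraph V where
  Adj := K.adj
  symm := ⟨fun u v h => ⟨h.1.symm, by rw [Finset.pair_comm]; exact h.2⟩⟩
  loopless := ⟨fun u h => h.1 rfl⟩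

theorem cell_adj {σ : Finset V} (hσ : σ ∈ K.faces) {v w : V} (hv : v ∈ σ) (hw : w ∈ σ)
    (hvw : v ≠ w) : (skel K).Adj v w :=
  ⟨hvw, K.down σ hσ _ (by intro t ht; simp at ht; rcases ht with rfl | rfl <;> assumption)
    (by simp)⟩

/-- The affine extension of the distance. -/
noncomputable def FF (K : SC V) (u : V) (x : V →₀ ℝ) : ℝ :=
  x.sum fun v r => r * ((skel K).dist u v : ℝ)

theorem FF_eq (u : V) (x : V →₀ ℝ) {σ : Finset V} (h : x.support ⊆ σ) :
    FF K u x = ∑ v ∈ σ, x v * ((skel K).dist u v : ℝ) :=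
  Finsupp.sum_of_support_subset _ h _ (by simp)

theorem FF_ge {u : V} {x : V →₀ ℝ} (hx : K.IsPoint x) {σ : Finset V} (h : x.support ⊆ σ) (M : ℕ)
    (hM : ∀ v ∈ σ, M ≤ (skel K).dist u v) : (M : ℝ) ≤ FF K u x := by
  rw [FF_eq u x h]
  calc (M : ℝ) = ∑ v ∈ σ, x v * (M : ℝ) := by rw [← Finset.sum_mul, point_sum hx h, one_mul]
    _ ≤ _ := Finset.sum_le_sum fun v hv =>
        mul_le_mul_of_nonneg_left (by exact_mod_cast hM v hv) (hx.1 v)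

theorem FF_le {u : V} {x : V →₀ ℝ} (hx : K.IsPoint x) {σ : Finset V} (h : x.support ⊆ σ) (M : ℕ)
    (hM : ∀ v ∈ σ, (skel K).dist u v ≤ M) : FF K u x ≤ (M : ℝ) := by
  rw [FF_eq u x h]
  calc _ ≤ ∑ v ∈ σ, x v * (M : ℝ) := Finset.sum_le_sum fun v hv =>
        mul_le_mul_of_nonneg_left (by exact_mod_cast hM v hv) (hx.1 v)
    _ = _ := by rw [← Finset.sum_mul, point_sum hx h, one_mul]

theorem cell_dist {σ : Finset V} (hσ : σ ∈ K.faces) {v w : V} (hv : v ∈ σ) (hw : w ∈ σ) (u : V) :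
    (skel K).dist u v ≤ (skel K).dist u w + 1 := by
  by_cases h : v = w
  · subst h; omega
  · exact dist_adj_le (cell_adj hσ hw hv (Ne.symm h))

theorem lipF (h3 : K.Is3Dim) (u : V) {x y : V →₀ ℝ} (hx : K.IsPoint x) (hy : K.IsPoint y)
    (hxy : K.SameCell x y) : cB * |FF K u x - FF K u y| ≤ stepD x y := by
  refine abs_le_of_sq (stepD_nonneg x y) cB_nonneg (C := 2) (by rw [cB_sq]; norm_num) ?_
  rw [FF_eq u x (Finset.subset_union_left (s₂ := y.support)),
    FF_eq u y (Finset.subset_union_right (s₁ := x.support))]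
  have hne : (x.support ∪ y.support).Nonempty := by
    rw [Finset.nonempty_iff_ne_empty]
    intro h
    exact K.not_mem_empty (h ▸ hxy)
  obtain ⟨a, ha, hmin⟩ := Finset.exists_min_image _ (fun v => (skel K).dist u v) hne
  refine cell_lin h3 hx hy hxy _ ((skel K).dist u a : ℝ) fun v hv => ⟨?_, ?_⟩
  · exact_mod_cast hmin v hv
  · exact_mod_cast cell_dist hxy hv ha u

theorem psi_lip (h3 : K.Is3Dim) (u : V) (M : ℕ) (hM1 : 1 ≤ M) (g : (V →₀ ℝ) → ℝ)
    (hg : ∀ x y, K.IsPoint x → K.IsPoint y → K.SameCell x y → cA * |g x - g y| ≤ stepD x y)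
    (hgM : ∀ x y, K.IsPoint x → K.IsPoint y → K.SameCell x y → (g x ≠ 0 ∨ g y ≠ 0) →
      ∀ v ∈ x.support ∪ y.support, M ≤ (skel K).dist u v)
    (x y : V →₀ ℝ) (hx : K.IsPoint x) (hy : K.IsPoint y) (hxy : K.SameCell x y) :
    (cA * (1 - y u) + cB * max 1 (min (FF K u y) M) + cA * g y) -
      (cA * (1 - x u) + cB * max 1 (min (FF K u x) M) + cA * g x) ≤ stepD x y := by
  have hA := cA_nonneg
  have hB := cB_nonneg
  have hM1' : (1 : ℝ) ≤ M := by exact_mod_cast hM1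
  have hnu : u ∉ x.support ∪ y.support → x u = 0 ∧ y u = 0 := by
    intro h
    simpa only [Finset.mem_union, Finsupp.mem_support_iff, ne_eq, not_or, not_not] using h
  by_cases hgz : g x ≠ 0 ∨ g y ≠ 0
  · have hl := hgM x y hx hy hxy hgz
    have h1 := FF_ge hx Finset.subset_union_left M hl
    have h2 := FF_ge hy Finset.subset_union_right M hl
    rw [min_eq_right h1, min_eq_right h2]
    have hu : u ∉ x.support ∪ y.support := by
      intro h
      have := hl u h
      rw [SimpleGraph.dist_self] at this
      omega
    rw [(hnu hu).1, (hnu hu).2]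
    have h4 := hg x y hx hy hxy
    have h5 := mul_le_mul_of_nonneg_left (neg_abs_le (g x - g y)) hA
    nlinarith
  · push Not at hgz
    rw [hgz.1, hgz.2]
    by_cases hu : u ∈ x.support ∪ y.support
    · have hl : ∀ v ∈ x.support ∪ y.support, (skel K).dist u v ≤ 1 := by
        intro v hv
        have := cell_dist hxy hv hu u
        rwa [SimpleGraph.dist_self] at this
      have h1 := FF_le hx Finset.subset_union_left 1 hl
      have h2 := FF_le hy Finset.subset_union_right 1 hl
      rw [Nat.cast_one] at h1 h2
      rw [max_eq_left ((min_le_left _ _).trans h1), max_eq_left ((min_le_left _ _).trans h2)]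
      have h4 := lipA h3 hx hy hxy u
      have h5 := mul_le_mul_of_nonneg_left (le_abs_self (x u - y u)) hA
      nlinarith
    · rw [(hnu hu).1, (hnu hu).2]
      have h1 := lipF h3 u hx hy hxy
      have h2 : max 1 (min (FF K u y) M) - max 1 (min (FF K u x) M) ≤ |FF K u x - FF K u y| := by
        have e1 := abs_max_sub_max_le_max 1 (min (FF K u y) M) 1 (min (FF K u x) M)
        have e2 := abs_min_sub_min_le_max (FF K u y) M (FF K u x) M
        simp only [sub_self, abs_zero] at e1 e2
        rw [max_eq_right (a := (0 : ℝ)) (abs_nonneg _)] at e1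
        rw [max_eq_left (b := (0 : ℝ)) (abs_nonneg _)] at e2
        rw [abs_sub_comm (FF K u x)]
        exact (le_abs_self _).trans (e1.trans e2)
      have h3 := mul_le_mul_of_nonneg_left h2 hB
      nlinarith

end CellGeom

section EdgePts

variable {V : Type*} [DecidableEq V] {K : SC V}

/-- Point on an edge. -/
noncomputable def ept (v w : V) (t : ℝ) : V →₀ ℝ :=
  Finsupp.single v (1 - t) + Finsupp.single w t

theorem ept_self (v : V) (t : ℝ) : ept v v t = Finsupp.single v 1 := by
  unfold ept
  rw [← Finsupp.single_add]; simp

theorem ept_zero (v w : V) : ept v w 0 = Finsupp.single v 1 := by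
  unfold ept; simp

theorem ept_one (v w : V) : ept v w 1 = Finsupp.single w 1 := by
  unfold ept; simp

theorem ept_symm (v w : V) (t : ℝ) : ept v w t = ept w v (1 - t) := by
  unfold ept; rw [add_comm]; congr 2; ring

theorem ept_supp (v w : V) (t : ℝ) : (ept v w t).support ⊆ {v, w} := by
  unfold ept
  refine Finsupp.support_add.trans (Finset.union_subset ?_ ?_)
  · exact Finsupp.support_single_subset.trans (by simp)
  · exact Finsupp.support_single_subset.trans (by simp)

theorem ept_sum (v w : V) (t : ℝ) : ((ept v w t).sum fun _ r => r) = 1 := by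
  unfold ept
  rw [Finsupp.sum_add_index' (by simp) (by simp), Finsupp.sum_single_index rfl,
    Finsupp.sum_single_index rfl]
  ring

theorem ept_point {v w : V} (h : ({v, w} : Finset V) ∈ K.faces) {t : ℝ} (h0 : 0 ≤ t)
    (h1 : t ≤ 1) : K.IsPoint (ept v w t) := by
  refine ⟨?_, ept_sum v w t, K.down _ h _ (ept_supp v w t) ?_⟩
  · intro a
    have e1 : 0 ≤ (Finsupp.single v (1 - t)) a := by
      rw [Finsupp.single_apply]; split_ifs <;> linarith
    have e2 : 0 ≤ (Finsupp.single w t) a := by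
      rw [Finsupp.single_apply]; split_ifs <;> linarith
    unfold ept
    rw [Finsupp.add_apply]
    linarith
  · intro he
    have := ept_sum v w t
    rw [Finsupp.support_eq_empty] at he
    rw [he] at this
    simp at this

theorem ept_cell {v w : V} (h : ({v, w} : Finset V) ∈ K.faces) {t t' : ℝ} (h0 : 0 ≤ t)
    (h1 : t ≤ 1) : K.SameCell (ept v w t) (ept v w t') := by
  refine K.down _ h _ (Finset.union_subset (ept_supp v w t) (ept_supp v w t')) ?_
  intro he
  have := (ept_point h h0 h1).2.2
  rw [(Finset.union_eq_empty.1 he).1] at this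
  exact K.not_mem_empty this

theorem ept_step {v w : V} (hvw : v ≠ w) (t t' : ℝ) : stepD (ept v w t) (ept v w t') = |t - t'| := by
  unfold stepD
  have : ept v w t - ept v w t' = Finsupp.single v (t' - t) + Finsupp.single w (t - t') := by
    ext a
    unfold ept
    simp only [Finsupp.add_apply, Finsupp.sub_apply, Finsupp.single_apply]
    split_ifs <;> ring
  rw [this, Finsupp.sum_of_support_subset (s := {v, w})]
  · rw [Finset.sum_pair hvw]
    simp only [Finsupp.add_apply, Finsupp.single_apply, if_true, hvw, hvw.symm, if_false]
    rw [show ((t' - t + 0) ^ 2 + (0 + (t - t')) ^ 2) / 2 = (t - t') ^ 2 by ring]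
    exact Real.sqrt_sq_eq_abs _
  · refine Finsupp.support_add.trans (Finset.union_subset ?_ ?_)
    · exact Finsupp.support_single_subset.trans (by simp)
    · exact Finsupp.support_single_subset.trans (by simp)
  · simp


theorem ptK_nonempty (hK : K.IsCAT0) : Nonempty (PtK K) := by
  obtain ⟨σ, hσ⟩ := hK.1
  have hne : σ.Nonempty := by
    rw [Finset.nonempty_iff_ne_empty]
    rintro rfl
    exact K.not_mem_empty hσ
  obtain ⟨v, hv⟩ := hne
  refine ⟨⟨ept v v 0, ept_point ?_ le_rfl zero_le_one⟩⟩
  exact K.down _ hσ _ (by simpa using hv) (by simp)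

/-- Totalized point constructor. -/
noncomputable def mkP (hK : K.IsCAT0) (x : V →₀ ℝ) : PtK K :=
  if h : K.IsPoint x then ⟨x, h⟩ else Classical.choice (ptK_nonempty hK)

theorem mkP_val (hK : K.IsCAT0) {x : V →₀ ℝ} (h : K.IsPoint x) : (mkP hK x).1 = x := by
  unfold mkP; rw [dif_pos h]

theorem adj_point {v w : V} (h : (skel K).Adj v w) {t : ℝ} (h0 : 0 ≤ t) (h1 : t ≤ 1) :
    K.IsPoint (ept v w t) := ept_point h.2 h0 h1

theorem adj_vert {v w : V} (h : (skel K).Adj v w) : K.IsPoint (Finsupp.single v 1) := by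
  rw [← ept_zero v w]; exact adj_point h le_rfl zero_le_one

theorem dist_vert {u w : V} (h : (skel K).dist u w ≠ 0) : K.IsPoint (Finsupp.single w 1) := by
  obtain ⟨k, hk⟩ := Nat.exists_eq_succ_of_ne_zero h
  obtain ⟨x, hx⟩ := exists_pred hk
  exact adj_vert (by first | exact hx.1 | exact hx.1.symm | exact hx.2 | exact hx.2.symm)

theorem dist_vert' {u w : V} (h : (skel K).dist u w ≠ 0) : K.IsPoint (Finsupp.single u 1) := by
  rw [SimpleGraph.dist_comm] at h
  exact dist_vert h

theorem ept_dist {v w : V} (h : (skel K).Adj v w) {t t' : ℝ} (h0 : 0 ≤ t) (h1 : t ≤ 1)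
    (h0' : 0 ≤ t') (h1' : t' ≤ 1) : K.pdist (ept v w t) (ept v w t') ≤ |t - t'| := by
  rw [← ept_step h.1]
  exact pdist_le_step (adj_point h h0 h1) (adj_point h h0' h1') (ept_cell h.2 h0 h1)

theorem FF_ept (u v w : V) (t : ℝ) :
    FF K u (ept v w t) = (1 - t) * (skel K).dist u v + t * (skel K).dist u w := by
  unfold FF ept
  rw [Finsupp.sum_add_index' (by simp) (by intros; ring), Finsupp.sum_single_index (by simp),
    Finsupp.sum_single_index (by simp)]

theorem FF_single (u v : V) : FF K u (Finsupp.single v 1) = (skel K).dist u v := by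
  rw [← ept_zero v v, FF_ept]; ring

theorem mem_supp_of_ne {x : V →₀ ℝ} {v : V} (h : x v ≠ 0) : v ∈ x.support :=
  Finsupp.mem_support_iff.2 h

theorem LB1 (h3 : K.Is3Dim) (hK : K.IsCAT0) {u w : V} {k : ℕ} (hk : 2 ≤ k)
    (hd : (skel K).dist u w = k) :
    2 * cA + (k - 2 : ℝ) * cB ≤ K.pdist (Finsupp.single u 1) (Finsupp.single w 1) := by
  have hl := psi_lip h3 u (k - 1) (by omega) (fun x => x w)
    (fun x y hx hy hxy => lipA h3 hx hy hxy w) (by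
      intro x y hx hy hxy hor v hv
      have hw : w ∈ x.support ∪ y.support := by
        rw [Finset.mem_union]
        exact hor.imp mem_supp_of_ne mem_supp_of_ne
      have := cell_dist hxy hw hv u
      omega)
  have h := lip_le hK _ hl (dist_vert' (u := u) (w := w) (by omega)) (dist_vert (u := u) (w := w) (by omega))
  have huw : u ≠ w := by
    rintro rfl
    rw [SimpleGraph.dist_self] at hd
    omega
  simp only [FF_single, hd, Finsupp.single_eq_same, SimpleGraph.dist_self] at h
  rw [Finsupp.single_eq_of_ne huw, Finsupp.single_eq_of_ne huw.symm] at h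
  have hk' : (2 : ℝ) ≤ k := by exact_mod_cast hk
  rw [Nat.cast_sub (by omega : 1 ≤ k)] at h
  push_cast at h
  rw [min_eq_right (by linarith : (k : ℝ) - 1 ≤ k), min_eq_left (by linarith : (0 : ℝ) ≤ k - 1),
    max_eq_right (by linarith : (1 : ℝ) ≤ k - 1), max_eq_left (by norm_num : (0 : ℝ) ≤ 1)] at h
  linarith

theorem LB1' (h3 : K.Is3Dim) (hK : K.IsCAT0) {u w : V} {k : ℕ} (hk : 2 ≤ k)
    (hd : k ≤ (skel K).dist u w) :
    2 * cA + (k - 2 : ℝ) * cB ≤ K.pdist (Finsupp.single u 1) (Finsupp.single w 1) := by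
  have h := LB1 h3 hK (u := u) (w := w) (by omega) rfl
  have : (k : ℝ) ≤ (skel K).dist u w := by exact_mod_cast hd
  nlinarith [cB_nonneg]

theorem ept_half {v w : V} (hvw : v ≠ w) (a : V) :
    ept v w (1 / 2) a = if a = v ∨ a = w then 1 / 2 else 0 := by
  unfold ept
  simp only [Finsupp.add_apply, Finsupp.single_apply]
  by_cases h1 : v = a
  · subst h1; simp [hvw.symm]; norm_num
  · by_cases h2 : w = a
    · subst h2; simp [hvw]
    · simp [h1, h2, Ne.symm h1, Ne.symm h2]

theorem min_supp {x : V →₀ ℝ} (hx : K.IsPoint x) {v w : V} (h : min (x v) (x w) ≠ 0) :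
    v ∈ x.support ∧ w ∈ x.support := by
  refine ⟨mem_supp_of_ne fun h0 => h ?_, mem_supp_of_ne fun h0 => h ?_⟩
  · rw [h0]; exact min_eq_left (hx.1 w)
  · rw [h0]; exact min_eq_right (hx.1 v)

theorem min_supp' {x y : V →₀ ℝ} (hx : K.IsPoint x) (hy : K.IsPoint y) {v w : V}
    (h : min (x v) (x w) ≠ 0 ∨ min (y v) (y w) ≠ 0) :
    v ∈ x.support ∪ y.support ∧ w ∈ x.support ∪ y.support := by
  rcases h with h | h
  · exact ⟨Finset.mem_union_left _ (min_supp hx h).1, Finset.mem_union_left _ (min_supp hx h).2⟩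
  · exact ⟨Finset.mem_union_right _ (min_supp hy h).1, Finset.mem_union_right _ (min_supp hy h).2⟩

theorem LB2 (h3 : K.Is3Dim) (hK : K.IsCAT0) {u v w : V} {n : ℕ} (hn : 2 ≤ n)
    (hv : (skel K).dist u v = n) (hw : (skel K).dist u w = n) (hvw : (skel K).Adj v w)
    (hx : ∀ x, (skel K).Adj x v → (skel K).Adj x w → (skel K).dist u x + 1 ≠ n) :
    3 / 2 * cA + (n - 1 : ℝ) * cB ≤ K.pdist (Finsupp.single u 1) (ept v w (1 / 2)) := by
  have hl := psi_lip h3 u n (by omega) (fun x => min (x v) (x w))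
    (fun x y hx hy hxy => lipMin h3 hx hy hxy v w) (by
      intro x y hx' hy hxy hor a ha
      obtain ⟨h1, h2⟩ := min_supp' hx' hy hor
      have e1 := cell_dist hxy h1 ha u
      by_contra hcon
      push Not at hcon
      refine hx a (cell_adj hxy ha h1 ?_) (cell_adj hxy ha h2 ?_) (by omega)
      · rintro rfl; omega
      · rintro rfl; omega)
  have h := lip_le hK _ hl (dist_vert' (u := u) (w := w) (by omega))
    (adj_point hvw (t := 1 / 2) (by norm_num) (by norm_num))
  have hne : ∀ a, (skel K).dist u a = n → u ≠ a := by
    rintro a hd rfl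
    rw [SimpleGraph.dist_self] at hd
    omega
  have huv := hne v hv
  have huw := hne w hw
  simp only [FF_single, FF_ept, hv, hw, Finsupp.single_eq_same, SimpleGraph.dist_self,
    ept_half hvw.1] at h
  rw [Finsupp.single_eq_of_ne huv.symm, Finsupp.single_eq_of_ne huw.symm] at h
  have hn' : (2 : ℝ) ≤ n := by exact_mod_cast hn
  rw [if_neg (by simp [huv, huw]), if_pos (by simp), if_pos (by simp),
    show (1 - 1 / 2 : ℝ) * n + 1 / 2 * n = n by ring] at h
  simp only [min_self] at h
  rw [max_eq_right (by linarith : (1 : ℝ) ≤ n), Nat.cast_zero,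
    min_eq_left (by linarith : (0 : ℝ) ≤ n), max_eq_left (by norm_num : (0 : ℝ) ≤ 1)] at h
  linarith

theorem adj_dist_ge (hK : K.IsCAT0) {v w : V} (h : (skel K).Adj v w) :
    1 ≤ K.pdist (Finsupp.single v 1) (Finsupp.single w 1) := by
  have hl := lip_le hK (fun x => (x w - x v) / 2) (by
    intro x y hx hy _
    have h1 := cell_diff hx hy w v h.1.symm
    have h2 := abs_le_of_sq_le_sq' h1 (stepD_nonneg x y)
    linarith [h2.1]) (adj_vert h) (adj_vert h.symm)
  simp only [Finsupp.single_eq_same] at hl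
  rw [Finsupp.single_eq_of_ne h.1, Finsupp.single_eq_of_ne h.1.symm] at hl
  linarith

theorem adj_dist (hK : K.IsCAT0) {v w : V} (h : (skel K).Adj v w) :
    K.pdist (Finsupp.single v 1) (Finsupp.single w 1) = 1 := by
  refine le_antisymm ?_ (adj_dist_ge hK h)
  have := ept_dist h (t := 0) (t' := 1) le_rfl zero_le_one zero_le_one le_rfl
  rw [ept_zero, ept_one] at this
  norm_num at this
  exact this

theorem mid_dist (hK : K.IsCAT0) {v w : V} (h : (skel K).Adj v w) :
    K.pdist (Finsupp.single v 1) (ept v w (1 / 2)) = 1 / 2 ∧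
    K.pdist (ept v w (1 / 2)) (Finsupp.single w 1) = 1 / 2 := by
  have h1 := ept_dist h (t := 0) (t' := 1 / 2) le_rfl zero_le_one (by norm_num) (by norm_num)
  have h2 := ept_dist h (t := 1 / 2) (t' := 1) (by norm_num) (by norm_num) zero_le_one le_rfl
  rw [ept_zero] at h1
  rw [ept_one] at h2
  have h4 := pdist_tri hK (adj_vert h) (adj_point h (t := 1 / 2) (by norm_num) (by norm_num))
    (adj_vert h.symm)
  rw [adj_dist hK h] at h4
  rw [zero_sub, abs_neg, abs_of_pos (by norm_num)] at h1
  rw [show (1 / 2 - 1 : ℝ) = -(1 / 2) by norm_num, abs_neg, abs_of_pos (by norm_num)] at h2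
  constructor <;> linarith

theorem flag3 (h3 : K.Is3Dim) (hK : K.IsCAT0) {u v w : V} (huv : (skel K).Adj u v)
    (huw : (skel K).Adj u w) (hvw : (skel K).Adj v w) : ({u, v, w} : Finset V) ∈ K.faces := by
  by_contra hno
  have hA := cA_nonneg
  have hm : K.IsPoint (ept v w (1 / 2)) := adj_point hvw (by norm_num) (by norm_num)
  have hl := lip_le hK (fun x => -cA * x u + cA * min (x v) (x w)) (by
    intro x y hx hy hxy
    have e1 := lipA h3 hx hy hxy u
    have e2 := lipMin h3 hx hy hxy v w
    by_cases hor : min (x v) (x w) ≠ 0 ∨ min (y v) (y w) ≠ 0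
    · have hs := min_supp' hx hy hor
      have hu : u ∉ x.support ∪ y.support := by
        intro hu
        apply hno
        refine K.down _ hxy _ ?_ (by simp)
        intro a ha
        simp only [Finset.mem_insert, Finset.mem_singleton] at ha
        rcases ha with rfl | rfl | rfl
        · exact hu
        · exact hs.1
        · exact hs.2
      simp only [Finset.mem_union, Finsupp.mem_support_iff, ne_eq, not_or, not_not] at hu
      rw [hu.1, hu.2]
      have := mul_le_mul_of_nonneg_left (neg_abs_le (min (x v) (x w) - min (y v) (y w))) hA
      linarith
    · push Not at hor
      rw [hor.1, hor.2]
      have := mul_le_mul_of_nonneg_left (le_abs_self (x u - y u)) hA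
      linarith) (adj_vert huv) hm
  simp only [Finsupp.single_eq_same, ept_half hvw.1] at hl
  rw [Finsupp.single_eq_of_ne huv.1.symm, Finsupp.single_eq_of_ne huw.1.symm,
    if_neg (by simp [huv.1, huw.1]), if_pos (by simp), if_pos (by simp)] at hl
  simp only [min_self] at hl
  have hcn := hK.2.2.2 _ _ _ _ (adj_vert huv) (adj_vert hvw) (adj_vert hvw.symm) hm
    (by rw [(mid_dist hK hvw).1, adj_dist hK hvw]) (by rw [(mid_dist hK hvw).2, adj_dist hK hvw])
  rw [adj_dist hK huv, adj_dist hK huw, adj_dist hK hvw] at hcn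
  have := cA_sq
  nlinarith

end EdgePts

section Input

variable {V : Type*} [DecidableEq V] {K : SC V}

/-- Vertex points. -/
noncomputable def vP (hK : K.IsCAT0) (v : V) : PtK K := mkP hK (Finsupp.single v 1)

/-- The metric on points. -/
noncomputable def dK (K : SC V) (x y : PtK K) : ℝ := K.pdist x.1 y.1

theorem cn0' (hK : K.IsCAT0) : CN0 (dK K) := cn0 hK

theorem dK_self (x : PtK K) : dK K x x = 0 := pdist_self x.2

theorem vP_adj (hK : K.IsCAT0) {v w : V} (h : (skel K).Adj v w) : dK K (vP hK v) (vP hK w) = 1 := by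
  unfold dK vP
  rw [mkP_val hK (adj_vert h), mkP_val hK (adj_vert h.symm), adj_dist hK h]

theorem vP_LB1 (h3 : K.Is3Dim) (hK : K.IsCAT0) {u w : V} {k : ℕ} (hk : 2 ≤ k)
    (hd : k ≤ (skel K).dist u w) :
    2 * cA + (k - 2 : ℝ) * cB ≤ dK K (vP hK u) (vP hK w) := by
  unfold dK vP
  rw [mkP_val hK (dist_vert' (u := u) (w := w) (by omega)),
    mkP_val hK (dist_vert (u := u) (w := w) (by omega))]
  exact LB1' h3 hK hk hd

theorem vP_nonadj (h3 : K.Is3Dim) (hK : K.IsCAT0) {u v w : V} (h1 : (skel K).Adj u v)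
    (h2 : (skel K).Adj v w) (hne : u ≠ w) (hna : ¬ (skel K).Adj u w) :
    8 / 3 ≤ dK K (vP hK u) (vP hK w) ^ 2 := by
  have hr : (skel K).Reachable u w := h1.reachable.trans h2.reachable
  have hd := hr.one_lt_dist_of_ne_of_not_adj hne hna
  have h := vP_LB1 h3 hK (u := u) (w := w) (k := 2) le_rfl hd
  have hA := cA_nonneg
  have := cA_sq
  push_cast at h
  nlinarith

theorem path_exists {G : SimpleGraph V} {p q : V} {k : ℕ} (hr : G.Reachable p q)
    (hd : G.dist p q = k) :
    ∃ f : ℕ → V, f 0 = p ∧ f k = q ∧ ∀ i < k, G.Adj (f i) (f (i + 1)) := by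
  obtain ⟨w, hw⟩ := hr.exists_walk_length_eq_dist
  refine ⟨w.getVert, w.getVert_zero, ?_, ?_⟩
  · rw [← hd, ← hw]; exact w.getVert_length
  · intro i hi
    exact w.adj_getVert_succ (by omega)

theorem vP_dist_le (hK : K.IsCAT0) {p q : V} (hr : (skel K).Reachable p q) :
    dK K (vP hK p) (vP hK q) ≤ (skel K).dist p q := by
  obtain ⟨f, h0, hk, hs⟩ := path_exists hr rfl
  have := (cn0' hK).path_dist dK_self (fun i => vP hK (f i)) _ 1
    (fun i hi => (vP_adj hK (hs i hi)).le)
  simp only [h0, hk] at this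
  linarith

theorem c4_input (h3 : K.Is3Dim) (hK : K.IsCAT0) (a b c d : V) (hab : (skel K).Adj a b)
    (hbc : (skel K).Adj b c) (hcd : (skel K).Adj c d) (hda : (skel K).Adj d a)
    (hac : a ≠ c) (hbd : b ≠ d) : (skel K).Adj a c ∨ (skel K).Adj b d := by
  by_contra hcon
  push Not at hcon
  have h := (cn0' hK).quad (vP hK a) (vP hK b) (vP hK d) (vP hK c)
  unfold qip at h
  rw [vP_adj hK hab, vP_adj hK hda.symm, vP_adj hK hbc, vP_adj hK hcd.symm] at h
  have h1 := vP_nonadj h3 hK hab hbc hac hcon.1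
  have h2 := vP_nonadj h3 hK hbc hcd hbd hcon.2
  linarith

theorem c5_aux (hK : K.IsCAT0) (a b c d : V) (hab : (skel K).Adj a b)
    (hbc : (skel K).Adj b c) (hcd : (skel K).Adj c d) :
    dK K (vP hK a) (vP hK c) ^ 2 + dK K (vP hK b) (vP hK d) ^ 2 ≤
      18 / 5 + 5 / 8 * dK K (vP hK d) (vP hK a) ^ 2 := by
  have h := (cn0' hK).path_right (vP hK a) (vP hK d)
    ((1 / 8) * dK K (vP hK a) (vP hK d) ^ 2 + 8 / 25) 0
    (fun i => mkP hK (ept b c ((i : ℝ) / 5))) 5 (by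
      intro i hi
      have h := (cn0' hK).quad_eighth (vP hK a) (vP hK d) (mkP hK (ept b c ((i : ℝ) / 5)))
        (mkP hK (ept b c (((i + 1 : ℕ) : ℝ) / 5)))
      have hi' : ((i + 1 : ℕ) : ℝ) ≤ 5 := by exact_mod_cast hi
      have hi0 : (0 : ℝ) ≤ i := by positivity
      push_cast at hi'
      have hle : dK K (mkP hK (ept b c ((i : ℝ) / 5))) (mkP hK (ept b c (((i + 1 : ℕ) : ℝ) / 5)))
          ≤ 1 / 5 := by
        unfold dK
        push_cast
        rw [mkP_val hK (adj_point hbc (by positivity) (by linarith)),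
          mkP_val hK (adj_point hbc (by positivity) (by linarith))]
        refine (ept_dist hbc (by positivity) (by linarith) (by positivity) (by linarith)).trans ?_
        rw [show (i : ℝ) / 5 - (i + 1) / 5 = -(1 / 5) by ring, abs_neg,
          abs_of_pos (by norm_num)]
      have e1 := pow_le_pow_left₀ ((cn0' hK).nonneg _ _) hle 2
      linarith)
  simp only [Nat.cast_zero, zero_div, ept_zero] at h
  rw [show ((5 : ℕ) : ℝ) / 5 = 1 by norm_num, ept_one] at h
  unfold qip at h
  change dK K (vP hK a) (vP hK c) ^ 2 + dK K (vP hK d) (vP hK b) ^ 2 -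
    dK K (vP hK a) (vP hK b) ^ 2 - dK K (vP hK d) (vP hK c) ^ 2 ≤ _ at h
  rw [vP_adj hK hab, vP_adj hK hcd.symm, (cn0' hK).symm (vP hK d) (vP hK b),
    (cn0' hK).symm (vP hK a) (vP hK d)] at h
  push_cast at h
  linarith

theorem c5_input (h3 : K.Is3Dim) (hK : K.IsCAT0) (a b c d e : V) (hab : (skel K).Adj a b)
    (hbc : (skel K).Adj b c) (hcd : (skel K).Adj c d) (hde : (skel K).Adj d e)
    (hea : (skel K).Adj e a)
    (hac : a ≠ c) (hbd : b ≠ d) (hce : c ≠ e) (hda : d ≠ a) (heb : e ≠ b) :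
    (skel K).Adj a c ∨ (skel K).Adj b d ∨ (skel K).Adj c e ∨ (skel K).Adj d a ∨
      (skel K).Adj e b := by
  by_contra hcon
  push Not at hcon
  obtain ⟨n1, n2, n3, n4, n5⟩ := hcon
  have h1 := vP_nonadj h3 hK hab hbc hac n1
  have h2 := vP_nonadj h3 hK hbc hcd hbd n2
  have h3' := vP_nonadj h3 hK hcd hde hce n3
  have h4 := vP_nonadj h3 hK hde hea hda n4
  have h5 := vP_nonadj h3 hK hea hab heb n5
  have g1 := c5_aux hK a b c d hab hbc hcd
  have g2 := c5_aux hK b c d e hbc hcd hde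
  have g3 := c5_aux hK c d e a hcd hde hea
  have g4 := c5_aux hK d e a b hde hea hab
  have g5 := c5_aux hK e a b c hea hab hbc
  linarith

theorem cAB : 0.577 < cA * cB := by
  have h1 := cA_sq
  have h2 := cB_sq
  have h3 := mul_nonneg cA_nonneg cB_nonneg
  have h4 : (cA * cB) ^ 2 = 1 / 3 := by rw [mul_pow, h1, h2]; norm_num
  nlinarith

theorem even_input (h3 : K.Is3Dim) (hK : K.IsCAT0) (u z p q : V) (N s : ℕ) (hN : 2 ≤ N)
    (hNs : N = 2 * s ∨ N = 2 * s + 1) (huz : (skel K).dist u z = N)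
    (hup : (skel K).Reachable u p) (huq : (skel K).Reachable u q)
    (dup : (skel K).dist u p = s) (dpz : (skel K).dist p z = N - s)
    (duq : (skel K).dist u q = N - s) (dqz : (skel K).dist q z = s) :
    (skel K).dist p q < N := by
  by_contra hcon
  push Not at hcon
  have hruz : (skel K).Reachable u z := SimpleGraph.Reachable.of_dist_ne_zero (by omega)
  obtain ⟨f, f0, fs, hf⟩ := path_exists hup dup
  obtain ⟨g, g0, gs, hg⟩ := path_exists (huq.symm.trans hruz) dqz
  have h := (cn0' hK).paths (fun i => vP hK (f i)) (fun i => vP hK (g i)) s s 1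
    (fun i hi => (vP_adj hK (hf i hi)).le) (fun i hi => (vP_adj hK (hg i hi)).le)
  simp only [f0, fs, g0, gs] at h
  unfold qip at h
  have l1 := vP_LB1 h3 hK hN huz.ge
  have l2 := vP_LB1 h3 hK hN hcon
  have u1 := vP_dist_le hK huq
  have u2 := vP_dist_le hK (hup.symm.trans hruz)
  rw [duq] at u1
  rw [dpz] at u2
  have e1 := pow_le_pow_left₀ ((cn0' hK).nonneg _ _) u1 2
  have e2 := pow_le_pow_left₀ ((cn0' hK).nonneg _ _) u2 2
  have hN' : (2 : ℝ) ≤ N := by exact_mod_cast hN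
  have hL : 0 ≤ 2 * cA + (N - 2 : ℝ) * cB := by
    have := cA_nonneg
    have := mul_nonneg (by linarith : (0 : ℝ) ≤ N - 2) cB_nonneg
    linarith
  have e3 := pow_le_pow_left₀ hL l1 2
  have e4 := pow_le_pow_left₀ hL l2 2
  have hsq : 2 * (((N - s : ℕ) : ℝ)) ^ 2 + 2 * (s : ℝ) ^ 2 ≤ (N : ℝ) ^ 2 + 1 := by
    rw [Nat.cast_sub (by omega)]
    rcases hNs with rfl | rfl
    · push_cast; nlinarith
    · push_cast; nlinarith
  have hexp : (2 * cA + (N - 2 : ℝ) * cB) ^ 2 =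
      4 * cA ^ 2 + 4 * (N - 2) * (cA * cB) + (N - 2) ^ 2 * cB ^ 2 := by ring
  rw [cA_sq, cB_sq] at hexp
  have := mul_le_mul_of_nonneg_left cAB.le (by linarith : (0 : ℝ) ≤ N - 2)
  nlinarith

/-- Half-step path. -/
noncomputable def hP (hK : K.IsCAT0) (f : ℕ → V) (i : ℕ) : PtK K :=
  mkP hK (ept (f (i / 2)) (f ((i + 1) / 2)) (1 / 2))

theorem hP_even (hK : K.IsCAT0) (f : ℕ → V) (j : ℕ) : hP hK f (2 * j) = vP hK (f j) := by
  unfold hP vP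
  rw [show 2 * j / 2 = j by omega, show (2 * j + 1) / 2 = j by omega, ept_self]

theorem hP_odd (hK : K.IsCAT0) (f : ℕ → V) (j : ℕ) :
    hP hK f (2 * j + 1) = mkP hK (ept (f j) (f (j + 1)) (1 / 2)) := by
  unfold hP
  rw [show (2 * j + 1) / 2 = j by omega, show (2 * j + 1 + 1) / 2 = j + 1 by omega]

theorem hP_step (hK : K.IsCAT0) (f : ℕ → V) (i : ℕ)
    (h : (skel K).Adj (f (i / 2)) (f (i / 2 + 1))) :
    dK K (hP hK f i) (hP hK f (i + 1)) ≤ 1 / 2 := by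
  have hm : K.IsPoint (ept (f (i / 2)) (f (i / 2 + 1)) (1 / 2)) :=
    adj_point h (by norm_num) (by norm_num)
  obtain ⟨j, hj | hj⟩ := Nat.even_or_odd' i
  · subst hj
    rw [show 2 * j / 2 = j by omega] at *
    rw [hP_even, hP_odd]
    unfold dK vP
    rw [mkP_val hK (adj_vert h), mkP_val hK hm]
    exact (mid_dist hK h).1.le
  · subst hj
    rw [show (2 * j + 1) / 2 = j by omega] at *
    rw [show 2 * j + 1 + 1 = 2 * (j + 1) by ring, hP_even, hP_odd]
    unfold dK vP
    rw [mkP_val hK (adj_vert h.symm), mkP_val hK hm]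
    exact (mid_dist hK h).2.le

theorem odd_input (h3 : K.Is3Dim) (hK : K.IsCAT0) (u v w p q : V) (n s t : ℕ) (hn : 2 ≤ n)
    (hst : n = s + t) (huv : (skel K).dist u v = n) (huw : (skel K).dist u w = n)
    (hvw : (skel K).Adj v w)
    (hno : ∀ x, (skel K).Adj x v → (skel K).Adj x w → (skel K).dist u x + 1 ≠ n)
    (hup : (skel K).Reachable u p) (huq : (skel K).Reachable u q)
    (dup : (skel K).dist u p = s) (dpv : (skel K).dist p v = t)
    (duq : (skel K).dist u q = s) (dqw : (skel K).dist q w = t) :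
    (skel K).dist p q < n := by
  by_contra hcon
  push Not at hcon
  have hruv : (skel K).Reachable u v := SimpleGraph.Reachable.of_dist_ne_zero (by omega)
  have hruw : (skel K).Reachable u w := SimpleGraph.Reachable.of_dist_ne_zero (by omega)
  obtain ⟨f, f0, fs, hf⟩ := path_exists hup dup
  obtain ⟨g, g0, gs, hg⟩ := path_exists (huq.symm.trans hruw) dqw
  have hm : K.IsPoint (ept v w (1 / 2)) := adj_point hvw (by norm_num) (by norm_num)
  have hmsym : ept w v (1 / 2) = ept v w (1 / 2) := by
    rw [ept_symm]; norm_num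
  obtain ⟨g', hg'0, hg't, hg't1, hg'⟩ : ∃ g' : ℕ → V, g' 0 = q ∧ g' t = w ∧ g' (t + 1) = v ∧
      ∀ i < t + 1, (skel K).Adj (g' i) (g' (i + 1)) := by
    refine ⟨fun i => if i ≤ t then g i else v, by simp [g0], by simp [gs], by simp, ?_⟩
    intro i hi
    rcases Nat.lt_or_ge i t with h | h
    · simp only [h.le, if_true, show i + 1 ≤ t from h]
      exact hg i h
    · have : i = t := by omega
      subst this
      simp only [le_refl, if_true, gs, show ¬ (i + 1 ≤ i) by omega, if_false]
      exact hvw.symm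
  have h := (cn0' hK).paths (hP hK f) (hP hK g') (2 * s) (2 * t + 1) (1 / 2)
    (fun i hi => hP_step hK f i (hf _ (by omega)))
    (fun i hi => hP_step hK g' i (hg' _ (by omega)))
  have z1 := hP_even hK f 0
  have z2 := hP_even hK g' 0
  rw [mul_zero] at z1 z2
  rw [z1, z2, hP_even, hP_odd, f0, fs, hg'0, hg't, hg't1, hmsym] at h
  unfold qip at h
  have l1 : 3 / 2 * cA + (n - 1 : ℝ) * cB ≤ dK K (vP hK u) (mkP hK (ept v w (1 / 2))) := by
    unfold dK vP
    rw [mkP_val hK hm, mkP_val hK (dist_vert' (u := u) (w := w) (by omega))]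
    exact LB2 h3 hK hn huv huw hvw hno
  have l2 := vP_LB1 h3 hK hn hcon
  have u1 := vP_dist_le hK huq
  have u2 := vP_dist_le hK (hup.symm.trans hruv)
  have u3 := (cn0' hK).tri (vP hK p) (vP hK v) (mkP hK (ept v w (1 / 2)))
  have u4 : dK K (vP hK v) (mkP hK (ept v w (1 / 2))) = 1 / 2 := by
    unfold dK vP
    rw [mkP_val hK hm, mkP_val hK (adj_vert hvw)]
    exact (mid_dist hK hvw).1
  rw [duq] at u1
  rw [dpv] at u2
  have u5 : dK K (vP hK p) (mkP hK (ept v w (1 / 2))) ≤ t + 1 / 2 := by linarith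
  have e1 := pow_le_pow_left₀ ((cn0' hK).nonneg _ _) u1 2
  have e2 := pow_le_pow_left₀ ((cn0' hK).nonneg _ _) u5 2
  have hn' : (2 : ℝ) ≤ n := by exact_mod_cast hn
  have hA := cA_nonneg
  have hB := cB_nonneg
  have e3 := pow_le_pow_left₀ (by
    have := mul_nonneg (by linarith : (0 : ℝ) ≤ n - 1) hB
    linarith) l1 2
  have e4 := pow_le_pow_left₀ (by
    have := mul_nonneg (by linarith : (0 : ℝ) ≤ n - 2) hB
    linarith) l2 2
  have x1 : (2 * cA + (n - 2 : ℝ) * cB) ^ 2 =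
      4 * cA ^ 2 + 4 * (n - 2) * (cA * cB) + (n - 2) ^ 2 * cB ^ 2 := by ring
  have x2 : (3 / 2 * cA + (n - 1 : ℝ) * cB) ^ 2 =
      9 / 4 * cA ^ 2 + 3 * (n - 1) * (cA * cB) + (n - 1) ^ 2 * cB ^ 2 := by ring
  rw [cA_sq, cB_sq] at x1 x2
  have m1 := mul_le_mul_of_nonneg_left cAB.le (by linarith : (0 : ℝ) ≤ n - 2)
  have m2 := mul_le_mul_of_nonneg_left cAB.le (by linarith : (0 : ℝ) ≤ n - 1)
  have hst' : (n : ℝ) = s + t := by exact_mod_cast hst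
  have hfin : (s : ℝ) ^ 2 + (t + 1 / 2 : ℝ) ^ 2 +
      ((2 * s : ℕ) : ℝ) * (((2 * t + 1 : ℕ) : ℝ) * (2 * (1 / 2) ^ 2)) = (n + 1 / 2) ^ 2 := by
    rw [hst']; push_cast; ring
  nlinarith

theorem metric_input (h3 : K.Is3Dim) (hK : K.IsCAT0) : MetricInput (skel K) where
  c4 := c4_input h3 hK
  c5 := c5_input h3 hK
  even := even_input h3 hK
  odd := odd_input h3 hK

end Input

section PathMoves

variable {V : Type*} {E : V → V → Prop}

theorem EPath.eq_of {p q : EPath E} (hl : p.len = q.len) (hf : ∀ i, i ≤ p.len → p.f i = q.f i) :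
    p = q := by
  have hff : p.f = q.f := by
    funext i
    rcases Nat.le_total i p.len with h | h
    · exact hf i h
    · rw [p.stable i h, q.stable i (hl ▸ h), hf _ le_rfl, hl]
  cases p; cases q
  simp only at hl hff
  subst hl; subst hff
  rfl

/-- Append an edge. -/
noncomputable def snocP (p : EPath E) (w : V) (h : E p.dst w) : EPath E where
  f i := if i ≤ p.len then p.f i else w
  len := p.len + 1
  step := by
    intro i hi
    rcases Nat.lt_or_ge i p.len with h1 | h1
    · rw [if_pos h1.le, if_pos (show i + 1 ≤ p.len from h1)]; exact p.step i h1
    · have : i = p.len := by omega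
      subst this
      rw [if_pos le_rfl, if_neg (by omega)]; exact h
  stable := by
    intro i hi
    rw [if_neg (by omega), if_neg (by omega)]

theorem snocP_len (p : EPath E) (w : V) (h : E p.dst w) : (snocP p w h).len = p.len + 1 := rfl

theorem snocP_f (p : EPath E) (w : V) (h : E p.dst w) (i : ℕ) (hi : i ≤ p.len) :
    (snocP p w h).f i = p.f i := if_pos hi

theorem snocP_f' (p : EPath E) (w : V) (h : E p.dst w) (i : ℕ) (hi : p.len < i) :
    (snocP p w h).f i = w := if_neg (by omega)

theorem snocP_src (p : EPath E) (w : V) (h : E p.dst w) : (snocP p w h).src = p.src :=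
  snocP_f p w h 0 (Nat.zero_le _)

theorem snocP_dst (p : EPath E) (w : V) (h : E p.dst w) : (snocP p w h).dst = w :=
  snocP_f' p w h _ (by rw [snocP_len]; omega)

theorem exists_snocP (p : EPath E) {n : ℕ} (hn : p.len = n + 1) :
    ∃ (q : EPath E) (h : E q.dst p.dst), q.len = n ∧ q.src = p.src ∧ p = snocP q p.dst h := by
  let q : EPath E :=
    { f := fun i => p.f (min i n)
      len := n
      step := by
        intro i hi
        rw [min_eq_left hi.le, min_eq_left (by omega)]
        exact p.step i (by omega)
      stable := by
        intro i hi
        rw [min_eq_right hi, min_self] }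
  have hq : q.dst = p.f n := by
    change p.f (min n n) = _
    rw [min_self]
  have h : E q.dst p.dst := by
    rw [hq]
    unfold EPath.dst
    rw [hn]
    exact p.step n (by omega)
  refine ⟨q, h, rfl, ?_, ?_⟩
  · change p.f (min 0 n) = p.f 0
    rw [Nat.zero_min]
  · refine EPath.eq_of hn ?_
    intro i hi
    rcases Nat.lt_or_ge i (n + 1) with h1 | h1
    · rw [snocP_f q _ h i (by change i ≤ n; omega)]
      change p.f i = p.f (min i n)
      rw [min_eq_left (by omega)]
    · rw [snocP_f' q _ h i (by change n < i; omega)]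
      have : i = p.len := by omega
      rw [this]; rfl

variable [DecidableEq V] {K : SC V}

theorem triv_dst {p q : EPath K.adj} (h : TrivMove K p q) : q.dst = p.dst := by
  obtain ⟨i, h1, h2, h3, h4, h5⟩ := h
  unfold EPath.dst
  rw [h5 q.len (by omega) le_rfl, h3]

theorem tri_dst {p q : EPath K.adj} (h : TriMove K p q) : q.dst = p.dst := by
  obtain ⟨i, h1, h2, h2', h3, h4, h5⟩ := h
  unfold EPath.dst
  rw [h5 q.len (by omega) le_rfl, h3]

theorem tt_dst {p q : EPath K.adj} (h : TTMove K p q) : q.dst = p.dst := by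
  obtain ⟨i, x, h1, h2, h3, h4, h5, _⟩ := h
  unfold EPath.dst
  rw [h3]
  exact h5 _ (by omega)

theorem triv_snoc {p q : EPath K.adj} (h : TrivMove K p q) (w : V) (hp : K.adj p.dst w)
    (hq : K.adj q.dst w) : TrivMove K (snocP p w hp) (snocP q w hq) := by
  obtain ⟨i, h1, h2, h3, h4, h5⟩ := h
  refine ⟨i, ?_, ?_, ?_, ?_, ?_⟩
  · rw [snocP_len]; omega
  · rw [snocP_f _ _ _ _ h1, snocP_f _ _ _ _ (by omega), h2]
  · rw [snocP_len, snocP_len]; omega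
  · intro j hj
    rw [snocP_f _ _ _ _ (by omega), snocP_f _ _ _ _ (by omega), h4 j hj]
  · intro j hij hj
    rcases Nat.lt_or_ge q.len j with h | h
    · rw [snocP_f' _ _ _ _ h, snocP_f' _ _ _ _ (by omega)]
    · rw [snocP_f _ _ _ _ h, snocP_f _ _ _ _ (by omega), h5 j hij h]

theorem tri_snoc {p q : EPath K.adj} (h : TriMove K p q) (w : V) (hp : K.adj p.dst w)
    (hq : K.adj q.dst w) : TriMove K (snocP p w hp) (snocP q w hq) := by
  obtain ⟨i, h1, h2, h2', h3, h4, h5⟩ := h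
  have e0 := snocP_f p w hp i (by omega)
  have e1 := snocP_f p w hp (i + 1) (by omega)
  have e2 := snocP_f p w hp (i + 2) (by omega)
  refine ⟨i, ?_, ?_, ?_, ?_, ?_, ?_⟩
  · rw [snocP_len]; omega
  · rw [e0, e1, e2]; exact h2
  · rw [e0, e1, e2]; exact h2'
  · rw [snocP_len, snocP_len]; omega
  · intro j hj
    rw [snocP_f _ _ _ _ (by omega), snocP_f _ _ _ _ (by omega), h4 j hj]
  · intro j hij hj
    rcases Nat.lt_or_ge q.len j with h | h
    · rw [snocP_f' _ _ _ _ h, snocP_f' _ _ _ _ (by omega)]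
    · rw [snocP_f _ _ _ _ h, snocP_f _ _ _ _ (by omega), h5 j hij h]

theorem tt_snoc {p q : EPath K.adj} (h : TTMove K p q) (w : V) (hp : K.adj p.dst w)
    (hq : K.adj q.dst w) : TTMove K (snocP p w hp) (snocP q w hq) := by
  obtain ⟨i, x, h1, h2, h3, h4, h5, h6, h7, h8, h9, h10, h11⟩ := h
  have e0 := snocP_f p w hp (i - 1) (by omega)
  have e1 := snocP_f p w hp i (by omega)
  have e2 := snocP_f p w hp (i + 1) (by omega)
  refine ⟨i, x, h1, ?_, ?_, ?_, ?_, ?_, ?_, ?_, ?_, ?_, ?_⟩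
  · rw [snocP_len]; omega
  · rw [snocP_len, snocP_len]; omega
  · rw [snocP_f _ _ _ _ (by omega), h4]
  · intro j hj
    rcases Nat.lt_or_ge q.len j with h | h
    · rw [snocP_f' _ _ _ _ h, snocP_f' _ _ _ _ (by omega)]
    · rw [snocP_f _ _ _ _ h, snocP_f _ _ _ _ (by omega), h5 j hj]
  · rw [e1]; exact h6
  · rw [e0, e2]; exact h7
  · rw [e0, e1]; exact h8
  · rw [e0, e1]; exact h9
  · rw [e1, e2]; exact h10
  · rw [e1, e2]; exact h11

theorem lift_tt {p q : EPath K.adj} (h : Relation.ReflTransGen (TTMove K) p q) (w : V)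
    (hp : K.adj p.dst w) (hq : K.adj q.dst w) :
    Relation.ReflTransGen (TTMove K) (snocP p w hp) (snocP q w hq) := by
  induction h with
  | refl => exact .refl
  | tail _ h2 ih =>
    have hb := hq
    rw [tt_dst h2] at hb
    exact (ih hb).tail (tt_snoc h2 w hb hq)

theorem lift_basic {p q : EPath K.adj} (h : Relation.ReflTransGen (BasicMove K) p q) (w : V)
    (hp : K.adj p.dst w) (hq : K.adj q.dst w) :
    Relation.ReflTransGen (BasicMove K) (snocP p w hp) (snocP q w hq) := by
  induction h with
  | refl => exact .refl
  | tail _ h2 ih =>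
    have hb := hq
    rcases h2 with h2 | h2 | h2
    · rw [triv_dst h2] at hb
      exact (ih hb).tail (Or.inl (triv_snoc h2 w hb hq))
    · rw [tri_dst h2] at hb
      exact (ih hb).tail (Or.inr (Or.inl (tri_snoc h2 w hb hq)))
    · rw [tt_dst h2] at hb
      exact (ih hb).tail (Or.inr (Or.inr (tt_snoc h2 w hb hq)))

theorem basic_of_tt {p q : EPath K.adj} (h : Relation.ReflTransGen (TTMove K) p q) :
    Relation.ReflTransGen (BasicMove K) p q := by
  induction h with
  | refl => exact .refl
  | tail _ h2 ih => exact ih.tail (Or.inr (Or.inr h2))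

theorem epath_walk (p : EPath K.adj) : ∀ i, i ≤ p.len →
    ∃ w : (skel K).Walk (p.f 0) (p.f i), w.length = i := by
  intro i
  induction i with
  | zero => intro _; exact ⟨.nil, rfl⟩
  | succ i ih =>
    intro hi
    obtain ⟨w, hw⟩ := ih (by omega)
    have ha : (skel K).Adj (p.f i) (p.f (i + 1)) := p.step i (by omega)
    exact ⟨w.concat ha, by rw [SimpleGraph.Walk.length_concat, hw]⟩

theorem epath_reach (p : EPath K.adj) : (skel K).Reachable p.src p.dst := by
  obtain ⟨w, _⟩ := epath_walk p p.len le_rfl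
  exact ⟨w⟩

theorem epath_dist_le (p : EPath K.adj) : (skel K).dist p.src p.dst ≤ p.len := by
  obtain ⟨w, hw⟩ := epath_walk p p.len le_rfl
  exact (SimpleGraph.dist_le w).trans hw.le

theorem geo_exists {u x : V} (hr : (skel K).Reachable u x) :
    ∃ γ : EPath K.adj, γ.src = u ∧ γ.dst = x ∧ γ.len = (skel K).dist u x := by
  obtain ⟨f, h0, hk, hs⟩ := path_exists hr rfl
  refine ⟨⟨fun i => f (min i ((skel K).dist u x)), (skel K).dist u x, ?_, ?_⟩, ?_, ?_, rfl⟩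
  · intro i hi
    rw [min_eq_left hi.le, min_eq_left (by omega)]
    exact hs i hi
  · intro i hi
    rw [min_eq_right hi, min_self]
  · change f (min 0 _) = u
    rw [Nat.zero_min, h0]
  · change f (min _ _) = x
    rw [min_self, hk]

theorem cd_eq (p : EPath K.adj) : K.cd p.src p.dst = (skel K).dist p.src p.dst := by
  unfold SC.cd
  apply le_antisymm
  · obtain ⟨γ, h1, h2, h3⟩ := geo_exists (epath_reach p)
    exact Nat.sInf_le ⟨γ, h1, h2, h3⟩
  · have hne : {n | ∃ q : EPath K.adj, q.src = p.src ∧ q.dst = p.dst ∧ q.len = n}.Nonempty :=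
      ⟨p.len, p, rfl, rfl, rfl⟩
    obtain ⟨q, h1, h2, h3⟩ := Nat.sInf_mem hne
    rw [← h3, ← h1, ← h2]
    exact epath_dist_le q

theorem len_zero_eq {p q : EPath K.adj} (hp : p.len = 0) (hq : q.len = 0) (h : p.src = q.src) :
    p = q := by
  refine EPath.eq_of (by omega) ?_
  intro i hi
  have : i = 0 := by omega
  subst this
  exact h

theorem card3 {a b c : V} (h1 : a ≠ b) (h2 : a ≠ c) (h3 : b ≠ c) :
    ({a, b, c} : Finset V).card = 3 := Finset.card_eq_three.2 ⟨a, b, c, h1, h2, h3, rfl⟩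

theorem exists_snocP' (p : EPath K.adj) {n : ℕ} {u w : V} (hn : p.len = n + 1) (hu : p.src = u)
    (hw : p.dst = w) :
    ∃ (q : EPath K.adj) (h : K.adj q.dst w), q.len = n ∧ q.src = u ∧ p = snocP q w h := by
  subst hu; subst hw
  exact exists_snocP p hn

theorem tt_thm (h3 : K.Is3Dim) (hK : K.IsCAT0) (u : V) : ∀ (n : ℕ) (w : V) (α β : EPath K.adj),
    α.len = n → β.len = n → α.src = u → β.src = u → α.dst = w → β.dst = w →
    (skel K).dist u w = n → Relation.ReflTransGen (TTMove K) α β := by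
  have hM := metric_input h3 hK
  intro n
  induction n with
  | zero =>
    intro w α β ha hb hs hs' _ _ _
    rw [len_zero_eq ha hb (hs.trans hs'.symm)]
  | succ n ih =>
    intro w α β ha hb hs hs' hd hd' hn
    obtain ⟨p, hp, pl, ps, rfl⟩ := exists_snocP' α ha hs hd
    obtain ⟨q, hq, ql, qs, rfl⟩ := exists_snocP' β hb hs' hd'
    clear ha hb hs hs' hd hd'
    have key : ∀ r : EPath K.adj, r.len = n → r.src = u → K.adj r.dst w →
        (skel K).dist u r.dst = n := by
      intro r h1 h2 h3
      have e1 := epath_dist_le r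
      have h3' : (skel K).Adj r.dst w := h3
      have e2 := dist_adj_le (u := u) h3'
      rw [h2] at e1
      omega
    have dp := key p pl ps hp
    have dq := key q ql qs hq
    by_cases hvv : p.dst = q.dst
    · exact lift_tt (ih _ p q pl ql ps qs rfl hvv.symm dp) _ _ _
    · have hp' : (skel K).Adj p.dst w := hp
      have hq' : (skel K).Adj q.dst w := hq
      have hadj : (skel K).Adj p.dst q.dst :=
        ((inc_tc hM n).1 u w p.dst q.dst hn hp'.symm hq'.symm dp dq).resolve_left hvv
      have hru : (skel K).Reachable u p.dst := ps ▸ epath_reach p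
      have hru' : (skel K).Reachable u q.dst := qs ▸ epath_reach q
      cases n with
      | zero =>
        exact absurd ((hru.dist_eq_zero_iff.1 dp).symm.trans (hru'.dist_eq_zero_iff.1 dq)) hvv
      | succ n =>
        obtain ⟨x, hxv, hxv', dx⟩ := (inc_tc hM n).2 u p.dst q.dst dp dq hadj
        obtain ⟨γ, gs, gd, gl⟩ := geo_exists (hru.trans hxv.symm.reachable)
        have g1 : K.adj γ.dst p.dst := by rw [gd]; exact hxv
        have g2 : K.adj γ.dst q.dst := by rw [gd]; exact hxv'
        have hxw : x ≠ w := by rintro rfl; omega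
        have m1 := ih _ p (snocP γ p.dst g1) pl (by rw [snocP_len, gl, dx]) ps
          (by rw [snocP_src, gs]) rfl (snocP_dst _ _ _) dp
        have m2 := ih _ (snocP γ q.dst g2) q (by rw [snocP_len, gl, dx]) ql
          (by rw [snocP_src, gs]) qs (snocP_dst _ _ _) rfl dq
        have l1 := lift_tt m1 w hp (by rw [snocP_dst]; exact hp)
        have l2 := lift_tt m2 w (by rw [snocP_dst]; exact hq) hq
        refine (l1.tail ?_).trans l2
        have f0 : (snocP (snocP γ p.dst g1) w (by rw [snocP_dst]; exact hp)).f γ.len = x := by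
          rw [snocP_f _ _ _ _ (by rw [snocP_len]; omega), snocP_f _ _ _ _ le_rfl]; exact gd
        have f1 : (snocP (snocP γ p.dst g1) w (by rw [snocP_dst]; exact hp)).f (γ.len + 1)
            = p.dst := by
          rw [snocP_f _ _ _ _ (by rw [snocP_len]), snocP_f' _ _ _ _ (by omega)]
        have f2 : (snocP (snocP γ p.dst g1) w (by rw [snocP_dst]; exact hp)).f (γ.len + 1 + 1)
            = w := by
          rw [snocP_f' _ _ _ _ (by rw [snocP_len]; omega)]
        refine ⟨γ.len + 1, q.dst, by omega, by rw [snocP_len, snocP_len]; omega, rfl, ?_, ?_,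
          ?_, ?_, ?_, ?_, ?_, ?_⟩
        · rw [snocP_f _ _ _ _ (by rw [snocP_len]), snocP_f' _ _ _ _ (by omega)]
        · intro j hj
          rcases Nat.lt_or_ge (γ.len + 1) j with h | h
          · rw [snocP_f' _ _ _ _ (by rw [snocP_len]; omega),
              snocP_f' _ _ _ _ (by rw [snocP_len]; omega)]
          · rw [snocP_f _ _ _ _ (by rw [snocP_len]; omega), snocP_f _ _ _ _ (by omega),
              snocP_f _ _ _ _ (by rw [snocP_len]; omega), snocP_f _ _ _ _ (by omega)]
        · rw [f1]; exact Ne.symm hvv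
        · rw [Nat.add_sub_cancel, f0, f2]; exact hxw
        · rw [Nat.add_sub_cancel, f0, f1]; exact flag3 h3 hK hxv hxv' hadj
        · rw [Nat.add_sub_cancel, f0, f1]; exact card3 hxv.1 hxv'.1 hadj.1
        · rw [f1, f2]; exact flag3 h3 hK hadj hp' hq'
        · rw [f1, f2]; exact card3 hadj.1 hp'.1 hq'.1

theorem basic_thm (h3 : K.Is3Dim) (hK : K.IsCAT0) (u : V) : ∀ (n : ℕ) (w : V) (α β : EPath K.adj),
    α.len = n → α.src = u → β.src = u → α.dst = w → β.dst = w →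
    β.len = (skel K).dist u w → Relation.ReflTransGen (BasicMove K) α β := by
  have hM := metric_input h3 hK
  intro n
  induction n with
  | zero =>
    intro w α β ha hs hs' hd hd' hb
    have e1 := epath_dist_le α
    rw [hs, hd] at e1
    rw [len_zero_eq ha (by omega) (hs.trans hs'.symm)]
  | succ n ih =>
    intro w α β ha hs hs' hd hd' hb
    obtain ⟨p, hp, pl, ps, rfl⟩ := exists_snocP' α ha hs hd
    clear ha hs hd
    have hp' : (skel K).Adj p.dst w := hp
    have hru : (skel K).Reachable u p.dst := ps ▸ epath_reach p
    have hrw : (skel K).Reachable u w := hru.trans hp'.reachable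
    have fin : ∀ δ : EPath K.adj, δ.len = (skel K).dist u w → δ.src = u → δ.dst = w →
        Relation.ReflTransGen (BasicMove K) δ β := fun δ h1 h2 h4 =>
      basic_of_tt (tt_thm h3 hK u _ w δ β h1 hb h2 hs' h4 hd' rfl)
    have c1 := dist_adj_le (u := u) hp'
    have c2 := dist_adj_le (u := u) hp'.symm
    rcases (by omega : (skel K).dist u w = (skel K).dist u p.dst + 1 ∨
        (skel K).dist u w = (skel K).dist u p.dst ∨
        (skel K).dist u p.dst = (skel K).dist u w + 1) with h | h | h
    · obtain ⟨γ, gs, gd, gl⟩ := geo_exists hru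
      have hg : K.adj γ.dst w := by rw [gd]; exact hp
      refine (lift_basic (ih _ p γ pl ps gs rfl gd gl) w hp hg).trans (fin _ ?_ ?_ ?_)
      · rw [snocP_len]; omega
      · rw [snocP_src, gs]
      · rw [snocP_dst]
    · obtain ⟨k, hk⟩ : ∃ k, (skel K).dist u w = k + 1 := by
        apply Nat.exists_eq_succ_of_ne_zero
        intro h0
        exact hp'.1 ((hru.dist_eq_zero_iff.1 (by omega)).symm.trans (hrw.dist_eq_zero_iff.1 h0))
      obtain ⟨x, hxv, hxw, dx⟩ := (inc_tc hM k).2 u p.dst w (by omega) hk hp'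
      obtain ⟨γ, gs, gd, gl⟩ := geo_exists (hru.trans hxv.symm.reachable)
      have g1 : K.adj γ.dst p.dst := by rw [gd]; exact hxv
      have g2 : K.adj γ.dst w := by rw [gd]; exact hxw
      have g3 : K.adj (snocP γ p.dst g1).dst w := by rw [snocP_dst]; exact hp
      have m1 := lift_basic (ih _ p (snocP γ p.dst g1) pl ps (by rw [snocP_src, gs]) rfl
        (snocP_dst _ _ _) (by rw [snocP_len]; omega)) w hp g3
      refine (m1.tail (b := snocP (snocP γ p.dst g1) w g3) (c := snocP γ w g2)
        (Or.inr (Or.inl ?_))).trans (fin _ ?_ ?_ ?_)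
      · have f0 : (snocP (snocP γ p.dst g1) w g3).f γ.len = x := by
          rw [snocP_f _ _ _ _ (by rw [snocP_len]; omega), snocP_f _ _ _ _ le_rfl]; exact gd
        have f1 : (snocP (snocP γ p.dst g1) w g3).f (γ.len + 1) = p.dst := by
          rw [snocP_f _ _ _ _ (by rw [snocP_len]), snocP_f' _ _ _ _ (by omega)]
        have f2 : (snocP (snocP γ p.dst g1) w g3).f (γ.len + 2) = w := by
          rw [snocP_f' _ _ _ _ (by rw [snocP_len]; omega)]
        refine ⟨γ.len, by rw [snocP_len, snocP_len], ?_, ?_, ?_, ?_, ?_⟩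
        · rw [f0, f1, f2]; exact flag3 h3 hK hxv hxw hp'
        · rw [f0, f1, f2]; exact card3 hxv.1 hxw.1 hp'.1
        · rw [snocP_len, snocP_len, snocP_len]
        · intro j hj
          rw [snocP_f _ _ _ _ hj, snocP_f _ _ _ _ (by rw [snocP_len]; omega),
            snocP_f _ _ _ _ hj]
        · intro j hj _
          rw [snocP_f' _ _ _ _ hj, snocP_f' _ _ _ _ (by rw [snocP_len]; omega)]
      · rw [snocP_len]; omega
      · rw [snocP_src, gs]
      · rw [snocP_dst]
    · obtain ⟨γ, gs, gd, gl⟩ := geo_exists hrw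
      have g1 : K.adj γ.dst p.dst := by rw [gd]; exact hp'.symm
      have g3 : K.adj (snocP γ p.dst g1).dst w := by rw [snocP_dst]; exact hp
      have m1 := lift_basic (ih _ p (snocP γ p.dst g1) pl ps (by rw [snocP_src, gs]) rfl
        (snocP_dst _ _ _) (by rw [snocP_len]; omega)) w hp g3
      refine (m1.tail (b := snocP (snocP γ p.dst g1) w g3) (c := γ)
        (Or.inl ?_)).trans (fin _ gl gs gd)
      refine ⟨γ.len, by rw [snocP_len, snocP_len], ?_, ?_, ?_, ?_⟩
      · rw [snocP_f' _ _ _ _ (by rw [snocP_len]; omega),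
          snocP_f _ _ _ _ (by rw [snocP_len]; omega), snocP_f _ _ _ _ le_rfl]
        exact gd.symm
      · rw [snocP_len, snocP_len]
      · intro j hj
        rw [snocP_f _ _ _ _ (by rw [snocP_len]; omega), snocP_f _ _ _ _ hj]
      · intro j hj hj'
        have : j = γ.len := by omega
        subst this
        rw [snocP_f' _ _ _ _ (by rw [snocP_len]; omega)]
        exact gd

theorem straighten_main (K : SC V) (h3 : K.Is3Dim) (hK : K.IsCAT0)
    (α β : EPath K.adj) (hsrc : α.src = β.src) (hdst : α.dst = β.dst) (hβ : K.IsGeo β) :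
    Relation.ReflTransGen (BasicMove K) α β ∧
      (K.IsGeo α → Relation.ReflTransGen (TTMove K) α β) := by
  have hb : β.len = (skel K).dist β.src β.dst := by rw [← cd_eq]; exact hβ
  refine ⟨basic_thm h3 hK β.src _ β.dst α β rfl hsrc rfl hdst rfl hb, fun hα => ?_⟩
  have ha : α.len = (skel K).dist β.src β.dst := by rw [← hsrc, ← hdst, ← cd_eq]; exact hα
  exact tt_thm h3 hK β.src _ β.dst α β ha hb hsrc rfl hdst rfl rfl

end PathMoves

/-- **Path Straightening.**  Let `K` be a CAT(0) regular simplicial 3-complex,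
and let `α` and `β` be combinatorial paths in `K` starting at a vertex `u` and ending at a
vertex `w`.  If `β` is a (possibly constant) combinatorial geodesic, then `α` can be
transformed into `β` by a finite sequence of basic moves (each of which is length-preserving
or length-reducing).  If both `α` and `β` are combinatorial geodesics, then all the moves are
length-preserving triangle-triangle moves. -/
theorem statement_12 {V : Type*} [DecidableEq V] (K : SC V) (h3 : K.Is3Dim) (hK : K.IsCAT0)
    (α β : EPath K.adj) (hsrc : α.src = β.src) (hdst : α.dst = β.dst) (hβ : K.IsGeo β) :
    Relation.ReflTransGen (BasicMove K) α β ∧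
      (K.IsGeo α → Relation.ReflTransGen (TTMove K) α β) := by
  exact straighten_main K h3 hK α β hsrc hdst hβ
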